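/- arXiv:2007.10622 — 4 statements merged into one kernel-verified Lean document; each statement's English description precedes it below -/
import Mathlib

section
/- For every C_0 > 0 and c > 0 there is a constant C > 0 such that the following holds for all integers n, T, R ≥ 2 and η ≥ 1. Let p be a probability distribution on ℝ^n supported on the closed Euclidean unit ball, and let w_1,…,w_R ∈ [1,η] be color weights. (1) For every nonempty finite test set S ⊂ ℝ^n with |S| ≤ (nT)^{C_0} and all vectors of Euclidean norm at most 1, taking ‖x‖_* = max_{z∈S}|⟨x,z⟩|, there exists an online coloring algorithm (measurable maps c_t : (ℝ^n)^t × [0,1]^t → {1,…,R}) such that, when v_1,…,v_T are i.i.d. with law p and u_1,…,u_T are independent uniform seeds, with probability at least 1 − C/T one has max_{c≠c'} ‖(d_c(t)/w_c − d_{c'}(t)/w_{c'})/(1/w_c + 1/w_{c'})‖_* ≤ C·(log(Rη))^2·(log(nT))^4 for all t ∈ {1,…,T}, where d_c(t) = Σ_{s≤t, c_s=c} v_s. (2) If moreover p has sub-exponential tails with constant c and ‖·‖_* is the norm whose unit ball is a symmetric convex body K ⊆ ℝ^n with standard Gaussian measure γ_n(K) ≥ 1/2, the same conclusion holds with bound C·(log(Rη))^2·(log(nT))^5.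 -/
open MeasureTheory Real Pointwise

/-- The one-dimensional unnormalised Gaussian profile of inverse variance `q`. -/
noncomputable def gaussProfile (q x : ℝ) : ℝ := Real.exp (-(q / 2) * x ^ 2)

/-- The one-sided alternating sum `∑ (-1)^j f (x + j)` of the Gaussian profile. -/
noncomputable def altGaussSum (q x : ℝ) : ℝ :=
  ∑' j : ℕ, (-1 : ℝ) ^ j * gaussProfile q (x + j)

lemma gaussProfile_pos (q x : ℝ) : 0 < gaussProfile q x := Real.exp_pos _

lemma gaussProfile_neg (q x : ℝ) : gaussProfile q (-x) = gaussProfile q x := by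
  simp [gaussProfile]

lemma gaussProfile_add_mul_two {q : ℝ} (x : ℝ) (k : ℝ) :
    gaussProfile q (x + 2 * k) = Real.exp (-π * (k + x / 2) ^ 2 * (2 * q / π)) := by
  unfold gaussProfile
  congr 1
  field_simp
  ring

lemma hasSum_gaussProfile_even {q : ℝ} (hq : 0 < q) (x : ℝ) :
    HasSum (fun k : ℤ => gaussProfile q (x + 2 * k))
      (HurwitzZeta.evenKernel ((x / 2 : ℝ) : UnitAddCircle) (2 * q / π)) := by
  have := HurwitzZeta.hasSum_int_evenKernel (x / 2) (t := 2 * q / π) (by positivity)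
  refine this.congr_fun fun k => ?_
  rw [gaussProfile_add_mul_two]

lemma summable_gaussProfile_int {q : ℝ} (hq : 0 < q) (x : ℝ) :
    Summable (fun k : ℤ => gaussProfile q (x + k)) := by
  have := (HurwitzZeta.hasSum_int_evenKernel x (t := q / (2 * π)) (by positivity)).summable
  refine this.congr fun k => ?_
  unfold gaussProfile
  congr 1
  field_simp
  ring

lemma summable_gaussProfile_nat {q : ℝ} (hq : 0 < q) (x : ℝ) :
    Summable (fun k : ℕ => gaussProfile q (x + k)) := by
  have := (summable_gaussProfile_int hq x).comp_injective Nat.cast_injective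
  simpa [Function.comp_def] using this

lemma summable_alt_gaussProfile {q : ℝ} (hq : 0 < q) (x : ℝ) :
    Summable (fun j : ℕ => (-1 : ℝ) ^ j * gaussProfile q (x + j)) := by
  refine Summable.of_norm_bounded (summable_gaussProfile_nat hq x) fun j => ?_
  simp [abs_of_pos (gaussProfile_pos q _)]

lemma altGaussSum_add_altGaussSum {q : ℝ} (hq : 0 < q) (x : ℝ) :
    altGaussSum q x + altGaussSum q (x + 1) = gaussProfile q x := by
  have h := (summable_alt_gaussProfile hq x).tsum_eq_zero_add
  have h2 : ∑' j : ℕ, (-1 : ℝ) ^ (j + 1) * gaussProfile q (x + (j + 1 : ℕ))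
      = - altGaussSum q (x + 1) := by
    rw [altGaussSum, ← tsum_neg]
    refine tsum_congr fun j => ?_
    rw [show x + ((j + 1 : ℕ) : ℝ) = x + 1 + j by push_cast; ring]
    ring
  rw [h2] at h
  rw [altGaussSum, h]
  simp

lemma gaussProfile_anti {q x y : ℝ} (hq : 0 < q) (hx : 0 ≤ x) (hxy : x ≤ y) :
    gaussProfile q y ≤ gaussProfile q x := by
  unfold gaussProfile
  apply Real.exp_le_exp.2
  have : x ^ 2 ≤ y ^ 2 := by gcongr
  nlinarith

lemma altGaussSum_mem {q x : ℝ} (hq : 0 < q) (hx : 0 ≤ x) :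
    0 ≤ altGaussSum q x ∧ altGaussSum q x ≤ gaussProfile q x := by
  have hl := (summable_alt_gaussProfile hq x).hasSum.tendsto_sum_nat
  have ha : Antitone (fun j : ℕ => gaussProfile q (x + j)) := by
    intro i j hij
    exact gaussProfile_anti hq (by positivity) (by gcongr)
  constructor
  · unfold altGaussSum
    simpa using ha.alternating_series_le_tendsto hl 0
  · unfold altGaussSum
    simpa using ha.tendsto_le_alternating_series hl 0

lemma altGaussSum_sub_altGaussSum {q : ℝ} (hq : 0 < q) (x : ℝ) :
    altGaussSum q (-x) - altGaussSum q (x + 1) =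
      HurwitzZeta.evenKernel ((x / 2 : ℝ) : UnitAddCircle) (2 * q / π) -
      HurwitzZeta.evenKernel (((x + 1) / 2 : ℝ) : UnitAddCircle) (2 * q / π) := by
  have hs : HasSum (fun k : ℤ => (-1 : ℝ) ^ k * gaussProfile q (x + k))
      (altGaussSum q (-x) - altGaussSum q (x + 1)) := by
    have e1 := (summable_alt_gaussProfile hq (x + 1)).hasSum.neg
    have e2 := (summable_alt_gaussProfile hq (-x)).hasSum
    refine HasSum.of_nat_of_neg_add_one (f := fun k : ℤ => (-1 : ℝ) ^ k * gaussProfile q (x + k))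
      (m := gaussProfile q x - altGaussSum q (x + 1)) (m' := altGaussSum q (-x) - gaussProfile q x)
      ?_ ?_ |>.congr_fun (fun _ => rfl) |> fun h => by convert h using 1; ring
    · rw [← altGaussSum_add_altGaussSum hq x, add_sub_cancel_right]
      unfold altGaussSum
      simpa using (summable_alt_gaussProfile hq x).hasSum
    · have h3 := altGaussSum_add_altGaussSum hq (-x)
      rw [gaussProfile_neg] at h3
      rw [show altGaussSum q (-x) - gaussProfile q x = - altGaussSum q (-x + 1) by linarith]
      refine ((summable_alt_gaussProfile hq (-x + 1)).hasSum.neg).congr_fun fun j => ?_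
      rw [show (-x + 1 + (j : ℝ)) = -(x + ((-(j + 1 : ℤ) : ℤ) : ℝ)) by push_cast; ring,
        gaussProfile_neg, zpow_neg, ← inv_zpow]
      norm_num
      rw [zpow_add₀ (by norm_num)]
      simp
  have he := hasSum_gaussProfile_even hq x
  have ho := hasSum_gaussProfile_even hq (x + 1)
  have h : HasSum (fun k : ℤ => (-1 : ℝ) ^ k * gaussProfile q (x + k))
      (HurwitzZeta.evenKernel ((x / 2 : ℝ) : UnitAddCircle) (2 * q / π) +
      -HurwitzZeta.evenKernel (((x + 1) / 2 : ℝ) : UnitAddCircle) (2 * q / π)) := by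
    have i1 : Function.Injective (fun k : ℤ => 2 * k) := fun a b h => by simpa using h
    have i2 : Function.Injective (fun k : ℤ => 2 * k + 1) := fun a b h => by simpa using h
    refine HasSum.add_isCompl (s := Set.range (fun k : ℤ => 2 * k))
      (t := Set.range (fun k : ℤ => 2 * k + 1)) ?_ ?_ ?_
    · have e1 : Set.range (fun k : ℤ => 2 * k) = {n | Even n} := by
        ext n; simp [even_iff_exists_two_mul]
      have e2 : Set.range (fun k : ℤ => 2 * k + 1) = {n | Odd n} := by
        ext n; simp [Odd]
      rw [e1, e2]
      exact Int.isCompl_even_odd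
    · refine (Function.Injective.hasSum_range_iff
        (f := fun k : ℤ => (-1 : ℝ) ^ k * gaussProfile q (x + k)) i1).2 ?_
      refine he.congr_fun fun k => ?_
      simp [zpow_mul]
    · refine (Function.Injective.hasSum_range_iff
        (f := fun k : ℤ => (-1 : ℝ) ^ k * gaussProfile q (x + k)) i2).2 ?_
      refine ho.neg.congr_fun fun k => ?_
      have : x + 1 + 2 * (k : ℝ) = x + (2 * k + 1) := by ring
      simp [zpow_add₀, zpow_mul, this]
  rw [hs.unique h]
  ring

lemma abs_cosKernel_sub_one_le (a : ℝ) {u : ℝ} (hu : 1 ≤ u) :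
    |HurwitzZeta.cosKernel (a : UnitAddCircle) u - 1| ≤ 4 * Real.exp (-π * u) := by
  have h := HurwitzZeta.hasSum_nat_cosKernel₀ a (t := u) (by linarith)
  have hpi := Real.pi_gt_three
  have hr : Real.exp (-π * u) ≤ 1 / 2 := by
    have h1 : Real.exp (-π * u) ≤ Real.exp (-1) := Real.exp_le_exp.2 (by nlinarith)
    have h2 := Real.exp_neg_one_lt_half
    linarith
  have hg := (hasSum_geometric_of_lt_one (Real.exp_pos (-π * u)).le (by linarith)).mul_left
    (2 * Real.exp (-π * u))
  have hb0 : ∀ n : ℕ, ‖2 * Real.cos (2 * π * a * (n + 1)) * Real.exp (-π * (n + 1) ^ 2 * u)‖ ≤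
      2 * Real.exp (-π * u) * Real.exp (-π * u) ^ n := fun n => by
    rw [Real.norm_eq_abs, abs_mul, abs_mul, Real.abs_exp, abs_of_nonneg (zero_le_two (α := ℝ)),
      mul_assoc (2 : ℝ), mul_assoc (2 : ℝ) (Real.exp _)]
    refine mul_le_mul_of_nonneg_left ?_ (zero_le_two (α := ℝ))
    calc |Real.cos (2 * π * a * (n + 1))| * Real.exp (-π * (n + 1) ^ 2 * u)
        ≤ 1 * Real.exp (-π * (n + 1) ^ 2 * u) := by
          gcongr
          exact Real.abs_cos_le_one _
      _ ≤ Real.exp (-π * u) * Real.exp (-π * u) ^ n := by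
          rw [one_mul, ← Real.exp_nat_mul, ← Real.exp_add]
          apply Real.exp_le_exp.2
          have hn : (0 : ℝ) ≤ n := by positivity
          have : 0 ≤ π * u * (n ^ 2 + n) := by positivity
          nlinarith
  have hb := h.norm_le_of_bounded hg hb0
  rw [Real.norm_eq_abs] at hb
  refine hb.trans ?_
  have : (1 - Real.exp (-π * u))⁻¹ ≤ 2 := by
    rw [inv_le_comm₀ (by linarith) (by norm_num)]
    linarith
  nlinarith [Real.exp_pos (-π * u)]

lemma abs_altGaussSum_sub_le {q : ℝ} (hq : 0 < q) (hq1 : q ≤ 1) (x : ℝ) :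
    |altGaussSum q (-x) - altGaussSum q (x + 1)| ≤ 8 * Real.exp (-1 / q) := by
  rw [altGaussSum_sub_altGaussSum hq, HurwitzZeta.evenKernel_functional_equation,
    HurwitzZeta.evenKernel_functional_equation, ← mul_sub]
  have hpi := Real.pi_gt_three
  set u : ℝ := 1 / (2 * q / π) with hu
  have hu' : u = π / (2 * q) := by rw [hu]; field_simp
  have hu1 : 3 / 2 * (1 / q) ≤ u := by
    rw [hu']
    have : π / (2 * q) = π / 2 * (1 / q) := by field_simp
    rw [this]
    gcongr
  have hq2 : 1 ≤ 1 / q := by rw [le_div_iff₀ hq]; linarith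
  have hu2 : 1 ≤ u := by linarith
  have h1 := abs_cosKernel_sub_one_le (x / 2) hu2
  have h2 := abs_cosKernel_sub_one_le ((x + 1) / 2) hu2
  have h3 : 1 / (2 * q / π) ^ (1 / 2 : ℝ) ≤ u := by
    have : 1 / (2 * q / π) ^ (1 / 2 : ℝ) = √u := by
      rw [← Real.sqrt_eq_rpow, hu, Real.sqrt_div zero_le_one, Real.sqrt_one]
    rw [this, Real.sqrt_le_left (by linarith)]
    nlinarith
  have h4 : u * Real.exp (-π * u) ≤ Real.exp (-1 / q) := by
    have : u ≤ Real.exp u := by linarith [Real.add_one_le_exp u]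
    calc u * Real.exp (-π * u) ≤ Real.exp u * Real.exp (-π * u) := by gcongr
      _ = Real.exp (u + -π * u) := by rw [Real.exp_add]
      _ ≤ Real.exp (-1 / q) := by
        apply Real.exp_le_exp.2
        rw [neg_div]
        nlinarith
  rw [abs_mul, abs_of_nonneg (by positivity)]
  have h5 : |HurwitzZeta.cosKernel ((x / 2 : ℝ) : UnitAddCircle) u -
      HurwitzZeta.cosKernel (((x + 1) / 2 : ℝ) : UnitAddCircle) u| ≤ 8 * Real.exp (-π * u) := by
    rw [abs_le] at *
    constructor <;> linarith
  calc _ ≤ u * (8 * Real.exp (-π * u)) := by gcongr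
    _ ≤ _ := by linarith

open Filter in
/-- The probability of moving by `+v` for the walk at `w`, where `q = |v|²` and `s = ⟨w, v⟩`. -/
noncomputable def upProb (q s : ℝ) : ℝ :=
  limUnder atTop fun N : ℕ => ∑ j ∈ Finset.range N, (-1 : ℝ) ^ j *
    (if s < 0 then Real.exp (-(j ^ 2 * q - 2 * j * s) / 2)
      else Real.exp (-((j + 1) ^ 2 * q + 2 * (j + 1) * s) / 2))

lemma measurable_upProb : Measurable fun z : ℝ × ℝ => upProb z.1 z.2 := by
  unfold upProb
  refine (MeasureTheory.StronglyMeasurable.limUnder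
    fun N => Measurable.stronglyMeasurable ?_).measurable
  refine Finset.measurable_sum _ fun j _ => ?_
  refine Measurable.const_mul ?_ _
  exact Measurable.ite (measurableSet_lt measurable_snd measurable_const) (by fun_prop)
    (by fun_prop)

lemma upProb_of_neg {q x : ℝ} (hq : 0 < q) (hx : x < 0) :
    upProb q (q * x) = altGaussSum q (-x) / gaussProfile q x := by
  refine Filter.Tendsto.limUnder_eq ?_
  refine ((summable_alt_gaussProfile hq (-x)).hasSum.div_const
    (gaussProfile q x)).tendsto_sum_nat.congr fun N => ?_
  refine Finset.sum_congr rfl fun j _ => ?_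
  rw [if_pos (mul_neg_of_pos_of_neg hq hx), mul_div_assoc, gaussProfile, gaussProfile,
    ← Real.exp_sub]
  congr 2
  ring

lemma upProb_of_nonneg {q x : ℝ} (hq : 0 < q) (hx : 0 ≤ x) :
    upProb q (q * x) = altGaussSum q (x + 1) / gaussProfile q x := by
  refine Filter.Tendsto.limUnder_eq ?_
  refine ((summable_alt_gaussProfile hq (x + 1)).hasSum.div_const
    (gaussProfile q x)).tendsto_sum_nat.congr fun N => ?_
  refine Finset.sum_congr rfl fun j _ => ?_
  rw [if_neg (not_lt.2 (mul_nonneg hq.le hx)), mul_div_assoc, gaussProfile, gaussProfile,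
    ← Real.exp_sub]
  congr 2
  ring

lemma upProb_mem {q : ℝ} (hq : 0 < q) (s : ℝ) : 0 ≤ upProb q s ∧ upProb q s ≤ 1 := by
  obtain ⟨x, rfl⟩ : ∃ x, s = q * x := ⟨s / q, by field_simp⟩
  have hf := gaussProfile_pos q x
  rcases lt_or_ge x 0 with hx | hx
  · rw [upProb_of_neg hq hx, div_le_one hf]
    have := altGaussSum_mem hq (x := -x) (by linarith)
    rw [gaussProfile_neg] at this
    exact ⟨div_nonneg this.1 hf.le, this.2⟩
  · rw [upProb_of_nonneg hq hx, div_le_one hf]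
    have := altGaussSum_mem hq (x := x + 1) (by linarith)
    exact ⟨div_nonneg this.1 hf.le, this.2.trans (gaussProfile_anti hq hx (by linarith))⟩

lemma gaussProfile_sub_one (q x : ℝ) :
    gaussProfile q (x - 1) = Real.exp (q * x - q / 2) * gaussProfile q x := by
  rw [gaussProfile, gaussProfile, ← Real.exp_add]
  congr 1
  ring

lemma gaussProfile_add_one (q x : ℝ) :
    gaussProfile q (x + 1) = Real.exp (-(q * x) - q / 2) * gaussProfile q x := by
  rw [gaussProfile, gaussProfile, ← Real.exp_add]
  congr 1
  ring

/-- One step of the walk almost preserves the one-dimensional Gaussian profile. -/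
lemma upProb_balance {q : ℝ} (hq : 0 < q) (hq1 : q ≤ 1) (s : ℝ) :
    upProb q (s - q) * Real.exp (s - q / 2) + (1 - upProb q (s + q)) * Real.exp (-s - q / 2) ≤
      1 + 16 * Real.exp (-1 / q) := by
  obtain ⟨x, rfl⟩ : ∃ x, s = q * x := ⟨s / q, by field_simp⟩
  have hf := gaussProfile_pos q x
  have hfm := gaussProfile_pos q (x - 1)
  have hfp := gaussProfile_pos q (x + 1)
  have e1 : Real.exp (q * x - q / 2) = gaussProfile q (x - 1) / gaussProfile q x := by
    rw [gaussProfile_sub_one]; field_simp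
  have e2 : Real.exp (-(q * x) - q / 2) = gaussProfile q (x + 1) / gaussProfile q x := by
    rw [gaussProfile_add_one]; field_simp
  rw [e1, e2, show q * x - q = q * (x - 1) by ring, show q * x + q = q * (x + 1) by ring]
  have key : ∀ a b : ℝ, a + gaussProfile q (x + 1) - b ≤
      (1 + 16 * Real.exp (-1 / q)) * gaussProfile q x →
      a / gaussProfile q (x - 1) * (gaussProfile q (x - 1) / gaussProfile q x) +
      (1 - b / gaussProfile q (x + 1)) * (gaussProfile q (x + 1) / gaussProfile q x) ≤
      1 + 16 * Real.exp (-1 / q) := by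
    intro a b hab
    have : a / gaussProfile q (x - 1) * (gaussProfile q (x - 1) / gaussProfile q x) +
      (1 - b / gaussProfile q (x + 1)) * (gaussProfile q (x + 1) / gaussProfile q x) =
      (a + gaussProfile q (x + 1) - b) / gaussProfile q x := by
      field_simp
      ring
    rw [this, div_le_iff₀ hf]
    exact hab
  have hε : 0 ≤ 16 * Real.exp (-1 / q) * gaussProfile q x := by positivity
  rcases lt_or_ge (x + 1) 0 with h1 | h1
  · rw [upProb_of_neg hq h1, upProb_of_neg hq (by linarith : x - 1 < 0)]
    apply key
    have a1 := altGaussSum_add_altGaussSum hq (-x)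
    have a2 := altGaussSum_add_altGaussSum hq (-(x + 1))
    rw [show -(x + 1) + 1 = -x by ring, gaussProfile_neg] at a2
    rw [gaussProfile_neg] at a1
    rw [show -(x - 1) = -x + 1 by ring]
    linarith
  · rcases lt_or_ge (x - 1) 0 with h2 | h2
    · rw [upProb_of_nonneg hq h1, upProb_of_neg hq h2]
      apply key
      have a1 := altGaussSum_add_altGaussSum hq (-x)
      have a2 := altGaussSum_add_altGaussSum hq (x + 1)
      rw [gaussProfile_neg] at a1
      rw [show -(x - 1) = -x + 1 by ring]
      have a3 := abs_le.1 (abs_altGaussSum_sub_le hq hq1 x)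
      have a4 : 1 / 2 ≤ gaussProfile q x := by
        unfold gaussProfile
        have h3 : x ^ 2 ≤ 1 := by nlinarith
        have h4 := Real.add_one_le_exp (-(q / 2) * x ^ 2)
        nlinarith
      nlinarith [Real.exp_pos (-1 / q)]
    · rw [upProb_of_nonneg hq h1, upProb_of_nonneg hq h2]
      apply key
      have a1 := altGaussSum_add_altGaussSum hq x
      have a2 := altGaussSum_add_altGaussSum hq (x + 1)
      rw [show x - 1 + 1 = x by ring]
      linarith

attribute [irreducible] upProb

/-- The standard Gaussian measure on `ℝ^n`. -/
noncomputable def stdGauss (n : ℕ) : Measure (Fin n → ℝ) :=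
  Measure.pi fun _ => ProbabilityTheory.gaussianReal 0 1

instance (n : ℕ) : IsProbabilityMeasure (stdGauss n) := by
  unfold stdGauss; infer_instance

/-- The uniform measure on `[0, 1]`. -/
noncomputable def unifUnit : Measure ℝ := volume.restrict (Set.Icc (0 : ℝ) 1)

instance : IsProbabilityMeasure unifUnit := ⟨by simp [unifUnit]⟩

/-- The density of the standard Gaussian measure. -/
noncomputable def gaussDensity {n : ℕ} (x : Fin n → ℝ) : ℝ :=
  (2 * π) ^ (-(n : ℝ) / 2) * Real.exp (-(∑ i, x i ^ 2) / 2)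

lemma gaussDensity_pos {n : ℕ} (x : Fin n → ℝ) : 0 < gaussDensity x := by
  unfold gaussDensity; positivity

lemma measurable_gaussDensity {n : ℕ} : Measurable (gaussDensity (n := n)) := by
  unfold gaussDensity
  fun_prop

lemma prod_gaussianPDFReal {n : ℕ} (x : Fin n → ℝ) :
    ∏ i, ProbabilityTheory.gaussianPDFReal 0 1 (x i) = gaussDensity x := by
  simp only [ProbabilityTheory.gaussianPDFReal, gaussDensity, Finset.prod_mul_distrib,
    Finset.prod_const, Finset.card_univ, Fintype.card_fin, ← Real.exp_sum]
  congr 1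
  · rw [NNReal.coe_one, mul_one, Real.sqrt_eq_rpow, ← Real.rpow_neg (by positivity),
      ← Real.rpow_natCast, ← Real.rpow_mul (by positivity)]
    congr 1
    ring
  · congr 1
    simp [Finset.sum_div, neg_div, Finset.sum_neg_distrib]

lemma stdGauss_eq_withDensity (n : ℕ) :
    stdGauss n = volume.withDensity fun x => ENNReal.ofReal (gaussDensity x) := by
  refine Measure.pi_eq fun s hs => ?_
  rw [withDensity_apply _ (MeasurableSet.univ_pi hs), volume_pi, Measure.restrict_pi_pi,
    ← ofReal_integral_eq_lintegral_ofReal]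
  · simp_rw [← prod_gaussianPDFReal]
    rw [integral_fintype_prod_eq_prod, ENNReal.ofReal_prod_of_nonneg]
    · refine Finset.prod_congr rfl fun i _ => ?_
      rw [ProbabilityTheory.gaussianReal_apply_eq_integral _ one_ne_zero]
    · intro i _
      exact integral_nonneg fun x => ProbabilityTheory.gaussianPDFReal_nonneg _ _ _
  · rw [show gaussDensity (n := n) = fun x => ∏ i, ProbabilityTheory.gaussianPDFReal 0 1 (x i) from
      funext fun x => (prod_gaussianPDFReal x).symm]
    exact Integrable.fintype_prod fun i =>
      (ProbabilityTheory.integrable_gaussianPDFReal 0 1).restrict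
  · exact ae_of_all _ fun x => (gaussDensity_pos x).le

lemma lintegral_stdGauss {n : ℕ} (F : (Fin n → ℝ) → ENNReal) (hF : Measurable F) :
    ∫⁻ x, F x ∂(stdGauss n) = ∫⁻ x, ENNReal.ofReal (gaussDensity x) * F x := by
  rw [stdGauss_eq_withDensity,
    lintegral_withDensity_eq_lintegral_mul _ measurable_gaussDensity.ennreal_ofReal hF]
  rfl

/-- One step of the walk with step `± v` from `w`, driven by the uniform variable `ξ`. -/
noncomputable def walkStep {n : ℕ} (v w : Fin n → ℝ) (ξ : ℝ) : Fin n → ℝ :=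
  if ξ ≤ upProb (v ⬝ᵥ v) (w ⬝ᵥ v) then w + v else w - v

lemma Measurable.dotProduct_fin {α : Type*} [MeasurableSpace α] {n : ℕ} {f g : α → Fin n → ℝ}
    (hf : Measurable f) (hg : Measurable g) : Measurable fun a => f a ⬝ᵥ g a :=
  Finset.measurable_sum _ fun i _ =>
    ((measurable_pi_apply i).comp hf).mul ((measurable_pi_apply i).comp hg)

lemma Measurable.upProb {α : Type*} [MeasurableSpace α] {f g : α → ℝ}
    (hf : Measurable f) (hg : Measurable g) : Measurable fun a => upProb (f a) (g a) :=
  measurable_upProb.comp (hf.prodMk hg)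

lemma measurable_walkStep {n : ℕ} :
    Measurable fun x : (Fin n → ℝ) × (Fin n → ℝ) × ℝ => walkStep x.1 x.2.1 x.2.2 := by
  unfold walkStep
  have h3 : MeasurableSet {x : (Fin n → ℝ) × (Fin n → ℝ) × ℝ |
      x.2.2 ≤ upProb (x.1 ⬝ᵥ x.1) (x.2.1 ⬝ᵥ x.1)} :=
    measurableSet_le measurable_snd.snd ((measurable_fst.dotProduct_fin measurable_fst).upProb
      (measurable_snd.fst.dotProduct_fin measurable_fst))
  exact Measurable.ite h3
    (measurable_snd.fst.add measurable_fst) (measurable_snd.fst.sub measurable_fst)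

lemma lintegral_unifUnit_ite {p : ℝ} (hp0 : 0 ≤ p) (hp1 : p ≤ 1) (a b : ENNReal) :
    ∫⁻ ξ, (if ξ ≤ p then a else b) ∂unifUnit =
      ENNReal.ofReal p * a + ENNReal.ofReal (1 - p) * b := by
  rw [← lintegral_add_compl _ (measurableSet_Iic (a := p)),
    setLIntegral_congr_fun (f := fun x => if x ≤ p then a else b) (g := fun _ => a)
      measurableSet_Iic (fun x hx => if_pos hx),
    setLIntegral_congr_fun (f := fun x => if x ≤ p then a else b) (g := fun _ => b)
      measurableSet_Iic.compl (fun x hx => if_neg hx),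
    setLIntegral_const, setLIntegral_const, unifUnit, Measure.restrict_apply measurableSet_Iic,
    Measure.restrict_apply measurableSet_Iic.compl,
    show Set.Iic p ∩ Set.Icc 0 1 = Set.Icc 0 p by
      ext x; simp only [Set.mem_inter_iff, Set.mem_Iic, Set.mem_Icc]; constructor
      · rintro ⟨h1, h2, h3⟩; exact ⟨h2, h1⟩
      · rintro ⟨h1, h2⟩; exact ⟨h2, h1, h2.trans hp1⟩,
    show (Set.Iic p)ᶜ ∩ Set.Icc 0 1 = Set.Ioc p 1 by
      ext x; simp only [Set.mem_inter_iff, Set.mem_compl_iff, Set.mem_Iic, Set.mem_Icc, not_le,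
        Set.mem_Ioc]; constructor
      · rintro ⟨h1, h2, h3⟩; exact ⟨h1, h3⟩
      · rintro ⟨h1, h2⟩; exact ⟨h1, hp0.trans h1.le, h2⟩]
  simp [mul_comm]

lemma gaussDensity_add {n : ℕ} (w v : Fin n → ℝ) :
    gaussDensity (w + v) = gaussDensity w * Real.exp (-(w ⬝ᵥ v) - v ⬝ᵥ v / 2) := by
  unfold gaussDensity
  rw [mul_assoc, ← Real.exp_add]
  congr 2
  simp only [dotProduct, Pi.add_apply, neg_div, Finset.sum_div]
  rw [← Finset.sum_neg_distrib, ← Finset.sum_neg_distrib,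
    ← Finset.sum_neg_distrib, ← Finset.sum_sub_distrib, ← Finset.sum_add_distrib]
  refine Finset.sum_congr rfl fun i _ => ?_
  ring

lemma gaussDensity_sub {n : ℕ} (w v : Fin n → ℝ) :
    gaussDensity (w - v) = gaussDensity w * Real.exp (w ⬝ᵥ v - v ⬝ᵥ v / 2) := by
  rw [sub_eq_add_neg, gaussDensity_add]
  simp

/-- A step of the walk almost preserves the standard Gaussian measure. -/
lemma lintegral_walkStep_le {n : ℕ} {v : Fin n → ℝ} {ε : ℝ} (hq1 : v ⬝ᵥ v ≤ 1)
    (hε : 0 < v ⬝ᵥ v → 16 * Real.exp (-1 / (v ⬝ᵥ v)) ≤ ε) (hε0 : 0 ≤ ε)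
    {F : (Fin n → ℝ) → ENNReal} (hF : Measurable F) :
    ∫⁻ w, ∫⁻ ξ, F (walkStep v w ξ) ∂unifUnit ∂(stdGauss n) ≤
      ENNReal.ofReal (1 + ε) * ∫⁻ w, F w ∂(stdGauss n) := by
  rcases eq_or_lt_of_le (show 0 ≤ v ⬝ᵥ v from Finset.sum_nonneg fun i _ => mul_self_nonneg _)
    with h0 | hq
  · have hv : v = 0 := dotProduct_self_eq_zero.1 h0.symm
    subst hv
    simp only [walkStep, add_zero, sub_zero, ite_self, lintegral_const, measure_univ, mul_one]
    exact le_mul_of_one_le_left' (by simpa using hε0)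
  have hup : ∀ w : Fin n → ℝ, ∫⁻ ξ, F (walkStep v w ξ) ∂unifUnit =
      ENNReal.ofReal (upProb (v ⬝ᵥ v) (w ⬝ᵥ v)) * F (w + v) +
      ENNReal.ofReal (1 - upProb (v ⬝ᵥ v) (w ⬝ᵥ v)) * F (w - v) := fun w => by
    obtain ⟨h1, h2⟩ := upProb_mem hq (w ⬝ᵥ v)
    rw [← lintegral_unifUnit_ite h1 h2]
    refine lintegral_congr fun ξ => ?_
    unfold walkStep
    split_ifs <;> rfl
  have hm : Measurable fun w : Fin n → ℝ => upProb (v ⬝ᵥ v) (w ⬝ᵥ v) :=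
    measurable_const.upProb (measurable_id.dotProduct_fin measurable_const)
  simp_rw [hup]
  rw [lintegral_stdGauss _ hF, lintegral_stdGauss _ (by fun_prop)]
  simp_rw [mul_add]
  have hmd := measurable_gaussDensity (n := n)
  rw [lintegral_add_left (by fun_prop), ← lintegral_const_mul _ (by fun_prop)]
  have t1 := lintegral_sub_right_eq_self (μ := (volume : Measure (Fin n → ℝ))) (fun w =>
    ENNReal.ofReal (gaussDensity w) * (ENNReal.ofReal (upProb (v ⬝ᵥ v) (w ⬝ᵥ v)) * F (w + v))) v
  have t2 := lintegral_add_right_eq_self (μ := (volume : Measure (Fin n → ℝ))) (fun w =>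
    ENNReal.ofReal (gaussDensity w) * (ENNReal.ofReal (1 - upProb (v ⬝ᵥ v) (w ⬝ᵥ v)) * F (w - v))) v
  have hm1 : Measurable fun w : Fin n → ℝ => upProb (v ⬝ᵥ v) ((w - v) ⬝ᵥ v) :=
    hm.comp (measurable_id.sub_const v)
  rw [← t1, ← t2, ← lintegral_add_left (by fun_prop)]
  refine lintegral_mono fun w => ?_
  simp only [sub_add_cancel, add_sub_cancel_right, sub_dotProduct, add_dotProduct]
  obtain ⟨h1, -⟩ := upProb_mem hq (w ⬝ᵥ v - v ⬝ᵥ v)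
  obtain ⟨-, h2⟩ := upProb_mem hq (w ⬝ᵥ v + v ⬝ᵥ v)
  have hd := gaussDensity_pos w
  rw [← mul_assoc, ← mul_assoc, ← mul_assoc, ← add_mul,
    ← ENNReal.ofReal_mul (gaussDensity_pos _).le, ← ENNReal.ofReal_mul (gaussDensity_pos _).le,
    ← ENNReal.ofReal_add
      (mul_nonneg (gaussDensity_pos _).le h1) (mul_nonneg (gaussDensity_pos _).le (by linarith)),
    ← ENNReal.ofReal_mul (by positivity)]
  gcongr
  rw [gaussDensity_add, gaussDensity_sub]
  have hb := upProb_balance hq hq1 (w ⬝ᵥ v)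
  have := hε hq
  have hb2 := mul_le_mul_of_nonneg_left (hb.trans (by linarith : _ ≤ 1 + ε)) hd.le
  linarith

/-- Extension of a finite sequence by zero. -/
def extendZero {α : Type*} [Zero α] {T : ℕ} (f : Fin T → α) (t : ℕ) : α :=
  if h : t < T then f ⟨t, h⟩ else 0

lemma extendZero_of_lt {α : Type*} [Zero α] {T : ℕ} (f : Fin T → α) {t : ℕ} (h : t < T) :
    extendZero f t = f ⟨t, h⟩ := dif_pos h

lemma extendZero_cons_zero {α : Type*} [Zero α] {T : ℕ} (x : α) (f : Fin T → α) :
    extendZero (Fin.cons x f : Fin (T + 1) → α) 0 = x := by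
  simp [extendZero]

lemma extendZero_cons_succ {α : Type*} [Zero α] {T : ℕ} (x : α) (f : Fin T → α) (t : ℕ) :
    extendZero (Fin.cons x f : Fin (T + 1) → α) (t + 1) = extendZero f t := by
  unfold extendZero
  by_cases h : t < T
  · rw [dif_pos h, dif_pos (by omega)]
    exact Fin.cons_succ (α := fun _ => α) x f ⟨t, h⟩
  · rw [dif_neg h, dif_neg (by omega)]

lemma measurable_extendZero {α : Type*} [Zero α] [MeasurableSpace α] {T : ℕ} :
    Measurable (extendZero : (Fin T → α) → ℕ → α) := by
  refine measurable_pi_lambda _ fun t => ?_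
  unfold extendZero
  by_cases h : t < T
  · simpa [h] using measurable_pi_apply _
  · simp [h]

/-- The walk with steps `± v t` started at `w`, driven by the uniform variables `ξ t`. -/
noncomputable def walk {n : ℕ} (v : ℕ → Fin n → ℝ) (w : Fin n → ℝ) (ξ : ℕ → ℝ) :
    ℕ → Fin n → ℝ
  | 0 => w
  | t + 1 => walkStep (v t) (walk v w ξ t) (ξ t)

lemma walk_succ_eq {n : ℕ} (v : ℕ → Fin n → ℝ) (w : Fin n → ℝ) (ξ : ℕ → ℝ) (t : ℕ) :
    walk v w ξ (t + 1) =
      walk (fun s => v (s + 1)) (walkStep (v 0) w (ξ 0)) (fun s => ξ (s + 1)) t := by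
  induction t with
  | zero => rfl
  | succ t ih => rw [walk, ih]; rfl

lemma walk_congr {n : ℕ} {v v' : ℕ → Fin n → ℝ} (w : Fin n → ℝ) (ξ : ℕ → ℝ) {t : ℕ}
    (h : ∀ s < t, v s = v' s) : walk v w ξ t = walk v' w ξ t := by
  induction t with
  | zero => rfl
  | succ t ih => rw [walk, walk, ih fun s hs => h s (by omega), h t (by omega)]

lemma Measurable.walk {α : Type*} [MeasurableSpace α] {n : ℕ} {v : α → ℕ → Fin n → ℝ}
    {w : α → Fin n → ℝ} {ξ : α → ℕ → ℝ} (hv : Measurable v) (hw : Measurable w)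
    (hξ : Measurable ξ) (t : ℕ) : Measurable fun a => walk (v a) (w a) (ξ a) t := by
  induction t with
  | zero => exact hw
  | succ t ih =>
    exact measurable_walkStep.comp
      (((measurable_pi_apply t).comp hv).prodMk (ih.prodMk ((measurable_pi_apply t).comp hξ)))

lemma lintegral_pi_fin_succ {α : Type*} [MeasurableSpace α] (μ : Measure α) [SigmaFinite μ]
    {T : ℕ} (F : (Fin (T + 1) → α) → ENNReal) (hF : Measurable F) :
    ∫⁻ ξ, F ξ ∂(Measure.pi fun _ => μ) =
      ∫⁻ x, ∫⁻ ξ, F (Fin.cons x ξ) ∂(Measure.pi fun _ : Fin T => μ) ∂μ := by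
  have h := (measurePreserving_piFinSuccAbove (fun _ : Fin (T + 1) => μ) 0).symm
  have hm : Measurable fun a : α × (Fin T → α) =>
      F ((MeasurableEquiv.piFinSuccAbove (fun _ => α) 0).symm a) :=
    hF.comp (MeasurableEquiv.measurable _)
  rw [← h.lintegral_comp hF, lintegral_prod _ hm.aemeasurable]
  simp [MeasurableEquiv.piFinSuccAbove, Fin.consEquiv]

/-- The law of the walk is dominated by a multiple of the standard Gaussian measure. -/
lemma lintegral_walk_le {n : ℕ} {ε : ℝ} (hε0 : 0 ≤ ε) {F : (Fin n → ℝ) → ENNReal}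
    (hF : Measurable F) (T t : ℕ) (ht : t ≤ T) (v : ℕ → Fin n → ℝ)
    (hv1 : ∀ t, v t ⬝ᵥ v t ≤ 1)
    (hv : ∀ t, 0 < v t ⬝ᵥ v t → 16 * Real.exp (-1 / (v t ⬝ᵥ v t)) ≤ ε) :
    ∫⁻ w, ∫⁻ ξ, F (walk v w (extendZero ξ) t) ∂(Measure.pi fun _ : Fin T => unifUnit)
        ∂(stdGauss n) ≤
      ENNReal.ofReal (1 + ε) ^ t * ∫⁻ w, F w ∂(stdGauss n) := by
  induction T generalizing t v with
  | zero =>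
    obtain rfl : t = 0 := by omega
    simp [walk]
  | succ T ih =>
    rcases t with _ | t
    · simp [walk]
    have hm : Measurable fun x : (Fin n → ℝ) × (Fin T → ℝ) =>
        F (walk (fun s => v (s + 1)) x.1 (extendZero x.2) t) :=
      hF.comp (measurable_const.walk measurable_fst (measurable_extendZero.comp measurable_snd) t)
    have hm' := hm.lintegral_prod_right' (ν := Measure.pi fun _ : Fin T => unifUnit)
    have key : ∀ w : Fin n → ℝ,
        ∫⁻ ξ, F (walk v w (extendZero ξ) (t + 1)) ∂(Measure.pi fun _ : Fin (T + 1) => unifUnit) =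
        ∫⁻ x, ∫⁻ ξ, F (walk (fun s => v (s + 1)) (walkStep (v 0) w x) (extendZero ξ) t)
          ∂(Measure.pi fun _ : Fin T => unifUnit) ∂unifUnit := fun w => by
      have hm1 : Measurable fun ξ : Fin (T + 1) → ℝ => F (walk v w (extendZero ξ) (t + 1)) :=
        hF.comp (measurable_const.walk measurable_const measurable_extendZero _)
      rw [lintegral_pi_fin_succ _ _ hm1]
      simp_rw [walk_succ_eq, extendZero_cons_zero, extendZero_cons_succ]
    simp_rw [key]
    refine (lintegral_walkStep_le (hv1 0) (hv 0) hε0 hm').trans ?_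
    rw [pow_succ', mul_assoc]
    gcongr
    exact ih t (by omega) _ (fun s => hv1 _) fun s => hv _

lemma pi_measure_le_of_forall_update {ι : Type*} [Fintype ι] [DecidableEq ι] {X : ι → Type*}
    [∀ i, MeasurableSpace (X i)] (μ : ∀ i, Measure (X i)) [∀ i, IsProbabilityMeasure (μ i)]
    (i : ι) {A : Set (∀ i, X i)} (hA : MeasurableSet A) (c : ENNReal)
    (h : ∀ x, μ i {y | Function.update x i y ∈ A} ≤ c) : Measure.pi μ A ≤ c := by
  rcases A.eq_empty_or_nonempty with rfl | ⟨x, -⟩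
  · simp
  rw [← lintegral_indicator_one hA, lintegral_eq_lmarginal_univ x,
    lmarginal_erase' _ (measurable_one.indicator hA) (Finset.mem_univ i)]
  calc _ ≤ (∫⋯∫⁻_(Finset.univ.erase i), (fun _ => c) ∂μ) x := by
        refine lmarginal_mono (fun y => ?_) x
        refine le_trans (le_of_eq ?_) (h y)
        have hu : MeasurableSet {z | Function.update y i z ∈ A} := (measurable_update y) hA
        rw [← lintegral_indicator_one hu]
        rfl
    _ = c := by simp [lmarginal]

/-- The walk attached to the node `a`, using only the vectors labelled `a`. -/
noncomputable def nodeWalk {n : ℕ} (v : ℕ → Fin n → ℝ) (L : ℕ → ℕ) (s : (Fin n → ℝ) × (ℕ → ℝ))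
    (a : ℕ) : ℕ → Fin n → ℝ :=
  walk (fun t => if L t = a then v t else 0) s.1 s.2

/-- The labels in the binary tree of walks: at each level, the walk of the current node of
the vector decides which child the vector goes to. -/
noncomputable def treeLabel {n : ℕ} (v : ℕ → Fin n → ℝ) (ω : ℕ → (Fin n → ℝ) × (ℕ → ℝ)) :
    ℕ → ℕ → ℕ
  | 0 => fun _ => 0
  | k + 1 => fun t => 2 * treeLabel v ω k t +
      if (ω k).2 t ≤ upProb (v t ⬝ᵥ v t)
        (nodeWalk v (treeLabel v ω k) (ω k) (treeLabel v ω k t) t ⬝ᵥ v t) then 0 else 1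

lemma treeLabel_succ {n : ℕ} (v : ℕ → Fin n → ℝ) (ω : ℕ → (Fin n → ℝ) × (ℕ → ℝ)) (k t : ℕ) :
    treeLabel v ω (k + 1) t = 2 * treeLabel v ω k t +
      if (ω k).2 t ≤ upProb (v t ⬝ᵥ v t)
        (nodeWalk v (treeLabel v ω k) (ω k) (treeLabel v ω k t) t ⬝ᵥ v t) then 0 else 1 := rfl

lemma treeLabel_lt {n : ℕ} (v : ℕ → Fin n → ℝ) (ω : ℕ → (Fin n → ℝ) × (ℕ → ℝ)) (k t : ℕ) :
    treeLabel v ω k t < 2 ^ k := by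
  induction k with
  | zero => simp [treeLabel]
  | succ k ih =>
    rw [treeLabel_succ, pow_succ]
    split_ifs <;> omega

lemma treeLabel_congr_seed {n : ℕ} (v : ℕ → Fin n → ℝ) {ω ω' : ℕ → (Fin n → ℝ) × (ℕ → ℝ)}
    {k : ℕ} (h : ∀ j < k, ω j = ω' j) : treeLabel v ω k = treeLabel v ω' k := by
  induction k with
  | zero => rfl
  | succ k ih =>
    rw [treeLabel, treeLabel, ih fun j hj => h j (by omega), h k (by omega)]

lemma treeLabel_congr {n : ℕ} {v v' : ℕ → Fin n → ℝ} (ω : ℕ → (Fin n → ℝ) × (ℕ → ℝ))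
    (k : ℕ) {t : ℕ} (h : ∀ s ≤ t, v s = v' s) : treeLabel v ω k t = treeLabel v' ω k t := by
  induction k generalizing t with
  | zero => rfl
  | succ k ih =>
    rw [treeLabel_succ, treeLabel_succ, ih h, h t le_rfl]
    have : nodeWalk v (treeLabel v ω k) (ω k) (treeLabel v' ω k t) t =
        nodeWalk v' (treeLabel v' ω k) (ω k) (treeLabel v' ω k t) t := by
      refine walk_congr _ _ fun s hs => ?_
      rw [ih fun r hr => h r (by omega), h s hs.le]
    rw [this]

lemma Measurable.nodeWalk {α : Type*} [MeasurableSpace α] {n : ℕ} {v : α → ℕ → Fin n → ℝ}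
    {L : α → ℕ → ℕ} {s : α → (Fin n → ℝ) × (ℕ → ℝ)} (hv : Measurable v) (hL : Measurable L)
    (hs : Measurable s) (a t : ℕ) : Measurable fun x => nodeWalk (v x) (L x) (s x) a t := by
  refine Measurable.walk (measurable_pi_lambda _ fun t => ?_) hs.fst hs.snd t
  exact Measurable.ite (((measurable_pi_apply t).comp hL) (measurableSet_singleton a))
    ((measurable_pi_apply t).comp hv) measurable_const

lemma Measurable.treeLabel {α : Type*} [MeasurableSpace α] {n : ℕ} {v : α → ℕ → Fin n → ℝ}
    {ω : α → ℕ → (Fin n → ℝ) × (ℕ → ℝ)} (hv : Measurable v) (hω : Measurable ω) (k : ℕ) :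
    Measurable fun x => treeLabel (v x) (ω x) k := by
  induction k with
  | zero => exact measurable_const
  | succ k ih =>
    refine measurable_pi_lambda _ fun t => ?_
    have hvt : Measurable fun x => v x t := (measurable_pi_apply t).comp hv
    have hωk : Measurable fun x => ω x k := (measurable_pi_apply k).comp hω
    have hlt : Measurable fun x => _root_.treeLabel (v x) (ω x) k t :=
      (measurable_pi_apply t).comp ih
    have hw : Measurable fun x => _root_.nodeWalk (v x) (_root_.treeLabel (v x) (ω x) k) (ω x k)
        (_root_.treeLabel (v x) (ω x) k t) t :=
      measurable_from_prod_countable_left (f := fun y : α × ℕ => _root_.nodeWalk (v y.1)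
        (_root_.treeLabel (v y.1) (ω y.1) k) (ω y.1 k) y.2 t) (fun a => hv.nodeWalk ih hωk a t)
        |>.comp (measurable_id.prodMk hlt)
    have hset := measurableSet_le ((measurable_pi_apply t).comp hωk.snd)
      ((hvt.dotProduct_fin hvt).upProb (hw.dotProduct_fin hvt))
    exact (hlt.const_mul 2).add (Measurable.ite hset measurable_const measurable_const)

/-- Infinite seed sequences from finite ones. -/
def extendSeed {n T D : ℕ} (ω : Fin D → (Fin n → ℝ) × (Fin T → ℝ)) (k : ℕ) :
    (Fin n → ℝ) × (ℕ → ℝ) :=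
  ((extendZero ω k).1, extendZero (extendZero ω k).2)

lemma measurable_extendSeed {n T D : ℕ} :
    Measurable (extendSeed : (Fin D → (Fin n → ℝ) × (Fin T → ℝ)) → _) := by
  refine measurable_pi_lambda _ fun k => ?_
  have h : Measurable fun ω : Fin D → (Fin n → ℝ) × (Fin T → ℝ) => extendZero ω k :=
    (measurable_pi_apply k).comp measurable_extendZero
  exact h.fst.prodMk (measurable_extendZero.comp h.snd)

lemma extendSeed_update_self {n T D : ℕ} (ω : Fin D → (Fin n → ℝ) × (Fin T → ℝ)) (k : Fin D)
    (s : (Fin n → ℝ) × (Fin T → ℝ)) :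
    extendSeed (Function.update ω k s) k = (s.1, extendZero s.2) := by
  simp [extendSeed, extendZero_of_lt]

lemma extendSeed_update_of_ne {n T D : ℕ} (ω : Fin D → (Fin n → ℝ) × (Fin T → ℝ)) (k : Fin D)
    (s : (Fin n → ℝ) × (Fin T → ℝ)) {j : ℕ} (hj : j < k) :
    extendSeed (Function.update ω k s) j = extendSeed ω j := by
  have hjD : j < D := hj.trans k.2
  have : (⟨j, hjD⟩ : Fin D) ≠ k := fun h => by simp [← h] at hj
  simp [extendSeed, extendZero_of_lt _ hjD, this]

/-- The law of the seeds of the tree of walks. -/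
noncomputable def seedMeasure (n T D : ℕ) : Measure (Fin D → (Fin n → ℝ) × (Fin T → ℝ)) :=
  Measure.pi fun _ => (stdGauss n).prod (Measure.pi fun _ => unifUnit)

instance (n T D : ℕ) : IsProbabilityMeasure (seedMeasure n T D) := by
  unfold seedMeasure; infer_instance

/-- The position at time `t` of the walk attached to the node `a` of level `k`. -/
noncomputable def treeWalk {n : ℕ} (v : ℕ → Fin n → ℝ) (ω : ℕ → (Fin n → ℝ) × (ℕ → ℝ))
    (k a t : ℕ) : Fin n → ℝ :=
  nodeWalk v (treeLabel v ω k) (ω k) a t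

lemma Measurable.treeWalk {α : Type*} [MeasurableSpace α] {n : ℕ} {v : α → ℕ → Fin n → ℝ}
    {ω : α → ℕ → (Fin n → ℝ) × (ℕ → ℝ)} (hv : Measurable v) (hω : Measurable ω) (k a t : ℕ) :
    Measurable fun x => treeWalk (v x) (ω x) k a t :=
  hv.nodeWalk (hv.treeLabel hω k) ((measurable_pi_apply k).comp hω) a t

lemma seedMeasure_treeWalk_le {n T D : ℕ} {ε : ℝ} (hε0 : 0 ≤ ε) {B : Set (Fin n → ℝ)}
    (hB : MeasurableSet B) {v : ℕ → Fin n → ℝ} (hv1 : ∀ t, v t ⬝ᵥ v t ≤ 1)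
    (hv : ∀ t, 0 < v t ⬝ᵥ v t → 16 * Real.exp (-1 / (v t ⬝ᵥ v t)) ≤ ε)
    (k : Fin D) (a : ℕ) {t : ℕ} (ht : t ≤ T) :
    seedMeasure n T D {ω | treeWalk v (extendSeed ω) k a t ∉ B} ≤
      ENNReal.ofReal (1 + ε) ^ t * stdGauss n Bᶜ := by
  have hm : Measurable fun ω : Fin D → (Fin n → ℝ) × (Fin T → ℝ) =>
      treeWalk v (extendSeed ω) k a t :=
    measurable_const.treeWalk measurable_extendSeed k a t
  refine pi_measure_le_of_forall_update _ k (hm hB.compl) _ fun ω => ?_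
  set L := treeLabel v (extendSeed ω) k with hL
  have hwalk : ∀ s, treeWalk v (extendSeed (Function.update ω k s)) k a t =
      walk (fun t => if L t = a then v t else 0) s.1 (extendZero s.2) t := fun s => by
    rw [treeWalk, extendSeed_update_self, nodeWalk,
      treeLabel_congr_seed v (ω' := extendSeed ω) fun j hj => extendSeed_update_of_ne ω k s hj]
  have hm2 : Measurable fun s : (Fin n → ℝ) × (Fin T → ℝ) =>
      walk (fun t => if L t = a then v t else 0) s.1 (extendZero s.2) t :=
    measurable_const.walk measurable_fst (measurable_extendZero.comp measurable_snd) t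
  have hset : {s | Function.update ω k s ∈ {ω | treeWalk v (extendSeed ω) k a t ∉ B}} =
      (fun s => walk (fun t => if L t = a then v t else 0) s.1 (extendZero s.2) t) ⁻¹' Bᶜ := by
    ext s
    simp only [Set.mem_ofPred_eq, Set.mem_preimage, Set.mem_compl_iff, hwalk]
  have hF : Measurable (Bᶜ.indicator (1 : (Fin n → ℝ) → ENNReal)) :=
    measurable_one.indicator hB.compl
  calc _ = _ := congrArg _ hset
    _ = ∫⁻ w, ∫⁻ ξ, Bᶜ.indicator 1 (walk (fun t => if L t = a then v t else 0) w (extendZero ξ) t)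
        ∂(Measure.pi fun _ : Fin T => unifUnit) ∂(stdGauss n) := by
      rw [← lintegral_indicator_one (hm2 hB.compl), lintegral_prod]
      · rfl
      · exact (measurable_one.indicator (hm2 hB.compl)).aemeasurable
    _ ≤ _ := by
      have := lintegral_walk_le hε0 hF T t ht (fun t => if L t = a then v t else 0)
        (fun s => by
          split_ifs
          · exact hv1 s
          · simp)
        (fun s => by
          split_ifs
          · exact hv s
          · simp)
      rwa [lintegral_indicator_one hB.compl] at this

/-- The event that all the walks of the tree stay in `B`. -/
def treeGood {n : ℕ} (B : Set (Fin n → ℝ)) (T D : ℕ) (v : ℕ → Fin n → ℝ)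
    (ω : ℕ → (Fin n → ℝ) × (ℕ → ℝ)) : Prop :=
  ∀ k < D, ∀ a < 2 ^ k, ∀ t ≤ T, treeWalk v ω k a t ∈ B

lemma measurableSet_treeGood {α : Type*} [MeasurableSpace α] {n : ℕ} {B : Set (Fin n → ℝ)}
    (hB : MeasurableSet B) (T D : ℕ) {v : α → ℕ → Fin n → ℝ}
    {ω : α → ℕ → (Fin n → ℝ) × (ℕ → ℝ)} (hv : Measurable v) (hω : Measurable ω) :
    MeasurableSet {x | treeGood B T D (v x) (ω x)} := by
  unfold treeGood
  simp only [Set.ofPred_forall]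
  refine MeasurableSet.iInter fun k => MeasurableSet.iInter fun _ => MeasurableSet.iInter fun a =>
    MeasurableSet.iInter fun _ => MeasurableSet.iInter fun t => MeasurableSet.iInter fun _ => ?_
  exact (hv.treeWalk hω k a t) hB

lemma sum_two_pow_le (D : ℕ) : ∑ k ∈ Finset.range D, (2 : ENNReal) ^ k ≤ 2 ^ D := by
  have h : ∑ k ∈ Finset.range D, 2 ^ k ≤ 2 ^ D := by
    rw [Nat.geomSum_eq le_rfl]
    exact (Nat.div_le_self _ _).trans (Nat.sub_le _ _)
  exact_mod_cast h

lemma seedMeasure_not_treeGood_le {n T D : ℕ} {ε : ℝ} (hε0 : 0 ≤ ε) {B : Set (Fin n → ℝ)}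
    (hB : MeasurableSet B) {v : ℕ → Fin n → ℝ} (hv1 : ∀ t, v t ⬝ᵥ v t ≤ 1)
    (hv : ∀ t, 0 < v t ⬝ᵥ v t → 16 * Real.exp (-1 / (v t ⬝ᵥ v t)) ≤ ε) :
    seedMeasure n T D {ω | ¬ treeGood B T D v (extendSeed ω)} ≤
      2 ^ D * ((T + 1 : ℕ) * (ENNReal.ofReal (1 + ε) ^ T * stdGauss n Bᶜ)) := by
  set c := ENNReal.ofReal (1 + ε) ^ T * stdGauss n Bᶜ
  have hsub : {ω : Fin D → (Fin n → ℝ) × (Fin T → ℝ) | ¬ treeGood B T D v (extendSeed ω)} ⊆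
      ⋃ k ∈ Finset.range D, ⋃ a ∈ Finset.range (2 ^ k), ⋃ t ∈ Finset.range (T + 1),
        {ω | treeWalk v (extendSeed ω) k a t ∉ B} := by
    intro ω hω
    simp only [treeGood, not_forall, Set.mem_ofPred_eq] at hω
    obtain ⟨k, hk, a, ha, t, ht, h⟩ := hω
    simp only [Set.mem_iUnion, Finset.mem_range]
    exact ⟨k, hk, a, ha, t, by omega, h⟩
  refine (measure_mono hsub).trans ((measure_biUnion_finset_le _ _).trans ?_)
  calc _ ≤ ∑ k ∈ Finset.range D, ((2 : ENNReal) ^ k * ((T + 1 : ℕ) * c)) := by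
        refine Finset.sum_le_sum fun k hk => ?_
        refine (measure_biUnion_finset_le _ _).trans ?_
        refine (Finset.sum_le_card_nsmul _ _ ((T + 1 : ℕ) * c) fun a ha => ?_).trans
          (by simp)
        refine (measure_biUnion_finset_le _ _).trans ?_
        refine (Finset.sum_le_card_nsmul _ _ c fun t ht => ?_).trans (by simp)
        have ht' : t ≤ T := by simpa [Nat.lt_succ_iff] using ht
        refine (seedMeasure_treeWalk_le hε0 hB hv1 hv ⟨k, Finset.mem_range.1 hk⟩ a ht').trans ?_
        have h1 : (1 : ENNReal) ≤ ENNReal.ofReal (1 + ε) := by simpa using hε0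
        exact mul_le_mul' (pow_le_pow_right₀ h1 ht') le_rfl
    _ ≤ _ := by
        rw [← Finset.sum_mul]
        gcongr
        exact sum_two_pow_le D

lemma exists_seed_map (n T D : ℕ) :
    ∃ g : ℝ → Fin D → (Fin n → ℝ) × (Fin T → ℝ),
      MeasurePreserving g unifUnit (seedMeasure n T D) := by
  obtain ⟨f, hf, hfm⟩ := (seedMeasure n T D).exists_measurable_map_eq
  have hp : Measurable (Set.projIcc (0 : ℝ) 1 zero_le_one) := continuous_projIcc.measurable
  refine ⟨f ∘ Set.projIcc 0 1 zero_le_one, hf.comp hp, ?_⟩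
  have h1 : (volume : Measure unitInterval).map Subtype.val = unifUnit :=
    map_comap_subtype_coe measurableSet_Icc _
  rw [← h1, Measure.map_map (hf.comp hp) measurable_subtype_coe, ← hfm]
  congr 1
  ext1 x
  simp

/-- With high probability all the walks of the tree stay in `B`. -/
lemma prod_pi_not_treeGood_le {n T D : ℕ} (hT : 0 < T) {σ ε : ℝ} (hσ : 1 ≤ σ)
    (hε : 16 * Real.exp (-σ ^ 2) ≤ ε) {B : Set (Fin n → ℝ)}
    (hB : MeasurableSet B) (p : Measure (Fin n → ℝ)) [IsProbabilityMeasure p]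
    (hp : ∀ᵐ v ∂p, v ⬝ᵥ v ≤ 1) {g : ℝ → Fin D → (Fin n → ℝ) × (Fin T → ℝ)}
    (hg : MeasurePreserving g unifUnit (seedMeasure n T D)) :
    ((Measure.pi fun _ : Fin T => p).prod (Measure.pi fun _ : Fin T => unifUnit))
      {x | ¬ treeGood B T D (extendZero (σ⁻¹ • x.1)) (extendSeed (g (x.2 ⟨0, hT⟩)))} ≤
      2 ^ D * ((T + 1 : ℕ) * (ENNReal.ofReal (1 + ε) ^ T * stdGauss n Bᶜ)) := by
  have hε0 : 0 ≤ ε := le_trans (by positivity) hε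
  have hgm : Measurable fun x : (Fin T → Fin n → ℝ) × (Fin T → ℝ) =>
      extendSeed (g (x.2 ⟨0, hT⟩)) :=
    measurable_extendSeed.comp (hg.measurable.comp ((measurable_pi_apply _).comp measurable_snd))
  have hsm : Measurable fun x : (Fin T → Fin n → ℝ) × (Fin T → ℝ) => σ⁻¹ • x.1 := by fun_prop
  have hvm : Measurable fun x : (Fin T → Fin n → ℝ) × (Fin T → ℝ) =>
      (extendZero (σ⁻¹ • x.1) : ℕ → Fin n → ℝ) :=
    measurable_extendZero.comp hsm
  have hms := (measurableSet_treeGood hB T D hvm hgm).compl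
  rw [Set.compl_ofPred] at hms
  rw [Measure.prod_apply hms]
  have hae : ∀ᵐ v ∂(Measure.pi fun _ : Fin T => p), ∀ t, v t ⬝ᵥ v t ≤ 1 := by
    rw [ae_all_iff]
    intro t
    exact (measurePreserving_eval (fun _ : Fin T => p) t).quasiMeasurePreserving.ae hp
  set C := 2 ^ D * ((T + 1 : ℕ) * (ENNReal.ofReal (1 + ε) ^ T * stdGauss n Bᶜ))
  calc _ ≤ ∫⁻ _v, C ∂(Measure.pi fun _ : Fin T => p) := by
        refine lintegral_mono_ae ?_
        filter_upwards [hae] with v hv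
        have hmp : MeasurePreserving (fun u : Fin T → ℝ => g (u ⟨0, hT⟩))
            (Measure.pi fun _ : Fin T => unifUnit) (seedMeasure n T D) :=
          hg.comp (measurePreserving_eval (fun _ : Fin T => unifUnit) _)
        have hq : ∀ t, (extendZero (σ⁻¹ • v) t : Fin n → ℝ) ⬝ᵥ extendZero (σ⁻¹ • v) t ≤
            (σ ^ 2)⁻¹ := fun t => by
          unfold extendZero
          split_ifs with h
          · have := hv ⟨t, h⟩
            simp only [Pi.smul_apply, smul_dotProduct, dotProduct_smul, smul_eq_mul]
            rw [← mul_assoc, ← mul_inv, ← sq]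
            exact mul_le_of_le_one_right (by positivity) this
          · simp only [dotProduct_zero]; positivity
        have hms2 : MeasurableSet {ω : Fin D → (Fin n → ℝ) × (Fin T → ℝ) |
            ¬ treeGood B T D (extendZero (σ⁻¹ • v)) (extendSeed ω)} :=
          (measurableSet_treeGood hB T D measurable_const measurable_extendSeed).compl
        refine le_trans (le_of_eq ?_) (seedMeasure_not_treeGood_le hε0 hB
          (v := extendZero (σ⁻¹ • v)) (fun t => (hq t).trans ?_) fun t ht => le_trans ?_ hε)
        · exact hmp.measure_preimage hms2.nullMeasurableSet
        · exact inv_le_one_of_one_le₀ (one_le_pow₀ hσ)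
        · gcongr
          rw [neg_div, one_div]
          exact neg_le_neg ((le_inv_comm₀ ht (by positivity)).1 (hq t))
    _ = C := by simp

lemma Convex.add_mem_smul {E : Type*} [AddCommGroup E] [Module ℝ E] {B : Set E}
    (hB : Convex ℝ B) {r s : ℝ} (hr : 0 ≤ r) (hs : 0 ≤ s) {x y : E} (hx : x ∈ r • B)
    (hy : y ∈ s • B) : x + y ∈ (r + s) • B := by
  rw [hB.add_smul hr hs]
  exact Set.add_mem_add hx hy

lemma Convex.smul_mem_smul {E : Type*} [AddCommGroup E] [Module ℝ E] {B : Set E}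
    (hB : Convex ℝ B) (hsym : ∀ x ∈ B, -x ∈ B) (h0 : (0 : E) ∈ B) {r d c : ℝ} (hr : 0 ≤ r)
    (hc : |c| * r ≤ d) {x : E} (hx : x ∈ r • B) : c • x ∈ d • B := by
  obtain ⟨y, hy, rfl⟩ := hx
  have hd : 0 ≤ d := le_trans (by positivity) hc
  rcases eq_or_lt_of_le hd with h | h
  · have : c * r = 0 := by
      have h1 : |c| * r = 0 := le_antisymm (h ▸ hc) (by positivity)
      rcases mul_eq_zero.1 h1 with h2 | h2
      · simp [abs_eq_zero.1 h2]
      · simp [h2]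
    refine ⟨0, h0, ?_⟩
    simp [smul_smul, this]
  · refine ⟨(c * r / d) • y, ?_, by simp only [smul_smul]; congr 1; field_simp⟩
    have habs : |c * r / d| ≤ 1 := by
      rw [abs_div, abs_mul, abs_of_nonneg hr, abs_of_pos h, div_le_one h]
      exact hc
    rcases le_total 0 (c * r / d) with h1 | h1
    · exact hB.smul_mem_of_zero_mem h0 hy ⟨h1, (le_abs_self _).trans habs⟩
    · rw [← neg_smul_neg]
      exact hB.smul_mem_of_zero_mem h0 (hsym y hy) ⟨by linarith, (neg_le_abs _).trans habs⟩

lemma Convex.mem_smul_mono {E : Type*} [AddCommGroup E] [Module ℝ E] {B : Set E}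
    (hB : Convex ℝ B) (hsym : ∀ x ∈ B, -x ∈ B) (h0 : (0 : E) ∈ B) {r s : ℝ} (hr : 0 ≤ r)
    (hrs : r ≤ s) {x : E} (hx : x ∈ r • B) : x ∈ s • B := by
  simpa using hB.smul_mem_smul hsym h0 (c := 1) hr (by simpa using hrs) hx

lemma Convex.sub_mem_smul {E : Type*} [AddCommGroup E] [Module ℝ E] {B : Set E}
    (hB : Convex ℝ B) (hsym : ∀ x ∈ B, -x ∈ B) (h0 : (0 : E) ∈ B) {r s : ℝ}
    (hr : 0 ≤ r) (hs : 0 ≤ s) {x y : E} (hx : x ∈ r • B)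
    (hy : y ∈ s • B) : x - y ∈ (r + s) • B := by
  have := hB.smul_mem_smul hsym h0 (c := -1) (d := s) hs (by simp) hy
  simpa [sub_eq_add_neg] using hB.add_mem_smul hr hs hx this

section Tree

variable {n : ℕ} (v : ℕ → Fin n → ℝ) (ω : ℕ → (Fin n → ℝ) × (ℕ → ℝ))

lemma walkStep_zero (w : Fin n → ℝ) (ξ : ℝ) : walkStep 0 w ξ = w := by
  unfold walkStep; split_ifs <;> simp

lemma treeWalk_succ (k a t : ℕ) : treeWalk v ω k a (t + 1) = treeWalk v ω k a t +
    ((if treeLabel v ω (k + 1) t = 2 * a then v t else 0) -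
      (if treeLabel v ω (k + 1) t = 2 * a + 1 then v t else 0)) := by
  change walkStep (if treeLabel v ω k t = a then v t else 0) (treeWalk v ω k a t) ((ω k).2 t) = _
  rw [treeLabel_succ]
  by_cases h : treeLabel v ω k t = a
  · rw [if_pos h]
    subst h
    change walkStep (v t) (treeWalk v ω k _ t) ((ω k).2 t) = treeWalk v ω k _ t +
      ((if _ + (if (ω k).2 t ≤ upProb (v t ⬝ᵥ v t) (treeWalk v ω k _ t ⬝ᵥ v t) then 0 else 1) = _
        then _ else _) - (if _ + (if (ω k).2 t ≤
        upProb (v t ⬝ᵥ v t) (treeWalk v ω k _ t ⬝ᵥ v t) then 0 else 1) = _ then _ else _))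
    unfold walkStep
    split_ifs <;> first | omega | simp [sub_eq_add_neg]
  · rw [if_neg h, walkStep_zero]
    split_ifs <;> first | omega | simp

lemma treeWalk_sub (k a t : ℕ) : treeWalk v ω k a t - treeWalk v ω k a 0 =
    ∑ s ∈ Finset.range t, ((if treeLabel v ω (k + 1) s = 2 * a then v s else 0) -
      (if treeLabel v ω (k + 1) s = 2 * a + 1 then v s else 0)) := by
  induction t with
  | zero => simp
  | succ t ih => rw [Finset.sum_range_succ, ← ih, treeWalk_succ]; abel

/-- The sum of the vectors with label below `j` up to time `t`. -/
noncomputable def prefixSum (k j t : ℕ) : Fin n → ℝ :=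
  ∑ s ∈ Finset.range t, if treeLabel v ω k s < j then v s else 0

/-- The deviation of `prefixSum` from the corresponding fraction of the full sum. -/
noncomputable def prefixDev (k j t : ℕ) : Fin n → ℝ :=
  prefixSum v ω k j t - ((j : ℝ) / 2 ^ k) • ∑ s ∈ Finset.range t, v s

lemma treeLabel_succ_div (k s : ℕ) : treeLabel v ω (k + 1) s / 2 = treeLabel v ω k s := by
  rw [treeLabel_succ]; split_ifs <;> omega

lemma prefixSum_even (k i t : ℕ) : prefixSum v ω (k + 1) (2 * i) t = prefixSum v ω k i t := by
  refine Finset.sum_congr rfl fun s _ => ?_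
  have := treeLabel_succ_div v ω k s
  congr 1
  rw [eq_iff_iff]
  omega

lemma prefixSum_odd (k i t : ℕ) : prefixSum v ω (k + 1) (2 * i + 1) t =
    (1 / 2 : ℝ) • (prefixSum v ω k i t + prefixSum v ω k (i + 1) t) +
      (1 / 2 : ℝ) • (treeWalk v ω k i t - treeWalk v ω k i 0) := by
  rw [treeWalk_sub]
  unfold prefixSum
  rw [← smul_add, ← Finset.sum_add_distrib, ← Finset.sum_add_distrib, Finset.smul_sum]
  refine Finset.sum_congr rfl fun s _ => ?_
  have := treeLabel_succ_div v ω k s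
  have h3 : ∀ x : Fin n → ℝ, x = (2 : ℝ)⁻¹ • x + (2 : ℝ)⁻¹ • x := fun x => by
    rw [← add_smul]; norm_num
  split_ifs <;> first | omega | (simp; done) | (simp; exact h3 _)

lemma prefixDev_even (k i t : ℕ) : prefixDev v ω (k + 1) (2 * i) t = prefixDev v ω k i t := by
  unfold prefixDev
  rw [prefixSum_even]
  congr 2
  push_cast
  rw [pow_succ]
  field_simp

lemma prefixDev_odd (k i t : ℕ) : prefixDev v ω (k + 1) (2 * i + 1) t =
    (1 / 2 : ℝ) • prefixDev v ω k i t + (1 / 2 : ℝ) • prefixDev v ω k (i + 1) t +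
      (1 / 2 : ℝ) • (treeWalk v ω k i t - treeWalk v ω k i 0) := by
  unfold prefixDev
  rw [prefixSum_odd]
  ext x
  simp only [Pi.add_apply, Pi.sub_apply, Pi.smul_apply, smul_eq_mul]
  push_cast
  rw [pow_succ]
  field_simp
  ring

variable {v ω} {B : Set (Fin n → ℝ)} {T D : ℕ}

lemma treeWalk_sub_mem (hB : Convex ℝ B) (hsym : ∀ x ∈ B, -x ∈ B)
    (h : treeGood B T D v ω) {k a t t' : ℕ} (hk : k < D)
    (ha : a < 2 ^ k) (ht : t ≤ T) (ht' : t' ≤ T) :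
    treeWalk v ω k a t - treeWalk v ω k a t' ∈ (2 : ℝ) • B := by
  rw [show (2 : ℝ) = 1 + 1 by norm_num, hB.add_smul zero_le_one zero_le_one, one_smul,
    sub_eq_add_neg]
  exact Set.add_mem_add (h k hk a ha t ht) (hsym _ (h k hk a ha t' ht'))

lemma prefixDev_mem (hB : Convex ℝ B) (hsym : ∀ x ∈ B, -x ∈ B) (h0 : (0 : Fin n → ℝ) ∈ B)
    (h : treeGood B T D v ω) {t : ℕ} (ht : t ≤ T) {k : ℕ} (hk : k ≤ D) {j : ℕ}
    (hj : j ≤ 2 ^ k) : prefixDev v ω k j t ∈ (k : ℝ) • B := by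
  induction k generalizing j with
  | zero =>
    have : prefixDev v ω 0 j t = 0 := by
      unfold prefixDev prefixSum
      have : j = 0 ∨ j = 1 := by simp at hj; omega
      rcases this with rfl | rfl <;> simp [treeLabel]
    rw [this]
    exact ⟨0, h0, by simp⟩
  | succ k ih =>
    rw [pow_succ] at hj
    rcases Nat.even_or_odd' j with ⟨i, rfl | rfl⟩
    · rw [prefixDev_even]
      exact hB.mem_smul_mono hsym h0 (by positivity) (by push_cast; linarith)
        (ih (by omega) (by omega))
    · rw [prefixDev_odd]
      have h1 := hB.smul_mem_smul hsym h0 (c := 1 / 2) (d := k / 2) (by positivity)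
        (by rw [abs_of_nonneg (by norm_num)]; linarith) (ih (by omega) (by omega : i ≤ 2 ^ k))
      have h2 := hB.smul_mem_smul hsym h0 (c := 1 / 2) (d := k / 2) (by positivity)
        (by rw [abs_of_nonneg (by norm_num)]; linarith) (ih (by omega) (by omega : i + 1 ≤ 2 ^ k))
      have h3 := hB.smul_mem_smul hsym h0 (c := 1 / 2) (d := 1) (by positivity)
        (by rw [abs_of_nonneg (by norm_num)]; norm_num)
        (treeWalk_sub_mem hB hsym h (by omega : k < D) (by omega : i < 2 ^ k) ht (Nat.zero_le T))
      have := hB.add_mem_smul (by positivity) zero_le_one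
        (hB.add_mem_smul (by positivity) (by positivity) h1 h2) h3
      convert this using 2
      push_cast
      ring

lemma vec_mem_of_treeGood (hB : Convex ℝ B) (hsym : ∀ x ∈ B, -x ∈ B)
    (h0 : (0 : Fin n → ℝ) ∈ B) (hD : 0 < D) (h : treeGood B T D v ω) {s : ℕ} (hs : s < T) :
    v s ∈ (2 : ℝ) • B := by
  have h1 := treeWalk_sub_mem hB hsym h (k := 0) (a := 0) (t := s + 1) (t' := s) hD (by simp)
    (by omega) (by omega)
  rw [treeWalk_succ, add_sub_cancel_left] at h1
  have h2 := treeLabel_lt v ω 1 s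
  have h3 : treeLabel v ω (0 + 1) s = 0 ∨ treeLabel v ω (0 + 1) s = 1 := by
    simp only [zero_add]; omega
  rcases h3 with h3 | h3 <;> rw [h3] at h1
  · simpa using h1
  · have := hB.smul_mem_smul hsym h0 (c := -1) (d := 2) (by positivity) (by simp) h1
    simpa using this

lemma sum_vec_mem_of_treeGood (hB : Convex ℝ B) (hsym : ∀ x ∈ B, -x ∈ B)
    (h0 : (0 : Fin n → ℝ) ∈ B) (hD : 0 < D) (h : treeGood B T D v ω) {t : ℕ} (ht : t ≤ T) :
    ∑ s ∈ Finset.range t, v s ∈ (2 * t : ℝ) • B := by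
  induction t with
  | zero => simpa using ⟨0, h0, by simp⟩
  | succ t ih =>
    rw [Finset.sum_range_succ]
    convert hB.add_mem_smul (by positivity) zero_le_two (ih (by omega))
      (vec_mem_of_treeGood hB hsym h0 hD h (by omega : t < T)) using 2
    push_cast
    ring

end Tree

/-- The index of the interval `[j c, j (c + 1))` containing `l`. -/
def blockColor {R : ℕ} (hR : 0 < R) (j : ℕ → ℕ) (l : ℕ) : Fin R :=
  ⟨Nat.findGreatest (fun c => j c ≤ l) (R - 1),
    (Nat.findGreatest_le _).trans_lt (Nat.sub_lt hR one_pos)⟩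

lemma blockColor_eq_iff {R : ℕ} (hR : 0 < R) {j : ℕ → ℕ} (hj : Monotone j) (h0 : j 0 = 0)
    {l : ℕ} (hl : l < j R) (c : Fin R) :
    blockColor hR j l = c ↔ j c ≤ l ∧ l < j (c + 1) := by
  rw [Fin.ext_iff]
  change Nat.findGreatest (fun c => j c ≤ l) (R - 1) = c ↔ _
  rw [Nat.findGreatest_eq_iff]
  have hc := c.2
  constructor
  · rintro ⟨-, h1, h2⟩
    constructor
    · by_cases h : (c : ℕ) = 0
      · simp [h, h0]
      · exact h1 h
    · by_cases h : (c : ℕ) + 1 ≤ R - 1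
      · exact not_le.1 (h2 (Nat.lt_succ_self _) h)
      · rwa [show (c : ℕ) + 1 = R by omega]
  · rintro ⟨h1, h2⟩
    exact ⟨by omega, fun _ => h1, fun m hm _ => not_le.2 (h2.trans_le (hj hm))⟩

/-- The cumulative weight of the first colors, as a fraction of `2 ^ D` rounded up. -/
noncomputable def weightThreshold {R : ℕ} (w : Fin R → ℝ) (D c : ℕ) : ℕ :=
  ⌈2 ^ D * ((∑ i ∈ Finset.univ.filter (fun i : Fin R => (i : ℕ) < c), w i) / ∑ i, w i)⌉₊

section Weights

variable {R : ℕ} {w : Fin R → ℝ}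

lemma weightThreshold_zero (D : ℕ) : weightThreshold w D 0 = 0 := by simp [weightThreshold]

lemma weightThreshold_mono (hw : ∀ i, 0 < w i) (D : ℕ) : Monotone (weightThreshold w D) := by
  intro a b hab
  unfold weightThreshold
  gcongr
  · exact Finset.sum_nonneg fun i _ => (hw i).le
  · exact fun i _ _ => (hw i).le

lemma weightThreshold_card (hw : ∀ i, 0 < w i) (D : ℕ) (hR : 0 < R) :
    weightThreshold w D R = 2 ^ D := by
  have : 0 < ∑ i, w i := Finset.sum_pos (fun i _ => hw i) ⟨⟨0, hR⟩, Finset.mem_univ _⟩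
  have h : ∑ i ∈ Finset.univ.filter (fun i : Fin R => (i : ℕ) < R), w i = ∑ i, w i := by simp
  rw [weightThreshold, h, div_self this.ne', mul_one]
  exact_mod_cast Nat.ceil_natCast (R := ℝ) (2 ^ D)

lemma abs_weightThreshold_sub_le (hw : ∀ i, 0 < w i) (D : ℕ) (a : Fin R) :
    |((weightThreshold w D (a + 1) : ℝ) / 2 ^ D - (weightThreshold w D a : ℝ) / 2 ^ D) -
      w a / ∑ i, w i| ≤ 1 / 2 ^ D := by
  have hW : 0 ≤ ∑ i, w i := Finset.sum_nonneg fun i _ => (hw i).le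
  have h : ∑ i ∈ Finset.univ.filter (fun i : Fin R => (i : ℕ) < a + 1), w i =
      ∑ i ∈ Finset.univ.filter (fun i : Fin R => (i : ℕ) < a), w i + w a := by
    have : (Finset.univ.filter fun i : Fin R => (i : ℕ) < a + 1) =
        insert a (Finset.univ.filter fun i : Fin R => (i : ℕ) < a) := by
      ext i
      simp only [Finset.mem_filter, Finset.mem_univ, true_and, Finset.mem_insert, Fin.ext_iff]
      omega
    rw [this, Finset.sum_insert (by simp), add_comm]
  unfold weightThreshold
  rw [h, add_div, mul_add]
  set x : ℝ :=
    2 ^ D * ((∑ i ∈ Finset.univ.filter (fun i : Fin R => (i : ℕ) < a), w i) / ∑ i, w i) with hx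
  set q := w a / ∑ i, w i with hq
  have hx0 : 0 ≤ x := by
    have : 0 ≤ ∑ i ∈ Finset.univ.filter (fun i : Fin R => (i : ℕ) < a), w i :=
      Finset.sum_nonneg fun i _ => (hw i).le
    positivity
  have hq0 : 0 ≤ q := div_nonneg (hw a).le hW
  have hp : (0 : ℝ) < 2 ^ D := by positivity
  have hxq : 0 ≤ x + 2 ^ D * q := by positivity
  have e1 := Nat.le_ceil x
  have e2 := Nat.ceil_lt_add_one hx0
  have e3 := Nat.le_ceil (x + 2 ^ D * q)
  have e4 := Nat.ceil_lt_add_one hxq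
  rw [← sub_div, show ((⌈x + 2 ^ D * q⌉₊ : ℝ) - ⌈x⌉₊) / 2 ^ D - q =
    ((⌈x + 2 ^ D * q⌉₊ : ℝ) - ⌈x⌉₊ - 2 ^ D * q) / 2 ^ D by field_simp, abs_div, abs_of_pos hp]
  gcongr
  rw [abs_le]
  constructor <;> linarith

end Weights

section Discrepancy

variable {n : ℕ} {v : ℕ → Fin n → ℝ} {ω : ℕ → (Fin n → ℝ) × (ℕ → ℝ)} {B : Set (Fin n → ℝ)}
  {T D : ℕ}

lemma sum_color_eq {R : ℕ} (hR : 0 < R) {j : ℕ → ℕ} (hj : Monotone j) (h0 : j 0 = 0)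
    (hjR : j R = 2 ^ D) (a : Fin R) (t : ℕ) :
    ∑ s ∈ Finset.range t, (if blockColor hR j (treeLabel v ω D s) = a then v s else 0) =
      prefixSum v ω D (j (a + 1)) t - prefixSum v ω D (j a) t := by
  unfold prefixSum
  rw [← Finset.sum_sub_distrib]
  refine Finset.sum_congr rfl fun s _ => ?_
  have h1 := blockColor_eq_iff hR hj h0 (hjR ▸ treeLabel_lt v ω D s) a
  have h2 : j a ≤ j (a + 1) := hj (Nat.le_succ _)
  simp only [h1]
  split_ifs <;> first | omega | simp

lemma color_sum_sub_mem (hB : Convex ℝ B) (hsym : ∀ x ∈ B, -x ∈ B) (h0 : (0 : Fin n → ℝ) ∈ B)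
    (hD : 0 < D) (hTD : T ≤ 2 ^ D) (h : treeGood B T D v ω) {R : ℕ} (hR : 0 < R)
    {w : Fin R → ℝ} (hw : ∀ i, 0 < w i) {t : ℕ} (ht : t ≤ T) (a : Fin R) :
    ∑ s ∈ Finset.range t,
      (if blockColor hR (weightThreshold w D) (treeLabel v ω D s) = a then v s else 0) -
      (w a / ∑ i, w i) • ∑ s ∈ Finset.range t, v s ∈ (2 * D + 2 : ℝ) • B := by
  have hm := weightThreshold_mono hw D
  have hle : ∀ c ≤ R, weightThreshold w D c ≤ 2 ^ D := fun c hc =>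
    (hm hc).trans (weightThreshold_card hw D hR).le
  rw [sum_color_eq hR hm (weightThreshold_zero D) (weightThreshold_card hw D hR)]
  have h1 := prefixDev_mem hB hsym h0 h ht le_rfl (hle (a + 1) a.2)
  have h2 := prefixDev_mem hB hsym h0 h ht le_rfl (hle a a.2.le)
  have h3 := hB.smul_mem_smul hsym h0 (d := 2) (by positivity)
    (c := ((weightThreshold w D (a + 1) : ℝ) / 2 ^ D - (weightThreshold w D a : ℝ) / 2 ^ D) -
      w a / ∑ i, w i) (by
      calc _ ≤ 1 / 2 ^ D * (2 * t : ℝ) := by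
            gcongr
            exact abs_weightThreshold_sub_le hw D a
        _ ≤ 1 / 2 ^ D * (2 * 2 ^ D : ℝ) := by
            gcongr
            exact_mod_cast ht.trans hTD
        _ = 2 := by field_simp) (sum_vec_mem_of_treeGood hB hsym h0 hD h ht)
  have := hB.add_mem_smul (by positivity) zero_le_two
    (hB.sub_mem_smul hsym h0 (by positivity) (by positivity) h1 h2) h3
  convert this using 1
  · congr 1; ring
  · unfold prefixDev
    simp only [sub_smul]
    abel

/-- If all walks of the tree stay in `B`, the weighted discrepancies are controlled. -/
lemma weighted_discrepancy_mem (hB : Convex ℝ B) (hsym : ∀ x ∈ B, -x ∈ B)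
    (h0 : (0 : Fin n → ℝ) ∈ B)
    (hD : 0 < D) (hTD : T ≤ 2 ^ D) (h : treeGood B T D v ω) {R : ℕ} (hR : 0 < R)
    {w : Fin R → ℝ} (hw : ∀ i, 0 < w i) {t : ℕ} (ht : t ≤ T) (a b : Fin R) :
    (1 / w a + 1 / w b)⁻¹ •
      ((w a)⁻¹ • ∑ s ∈ Finset.range t,
        (if blockColor hR (weightThreshold w D) (treeLabel v ω D s) = a then v s else 0) -
      (w b)⁻¹ • ∑ s ∈ Finset.range t,
        (if blockColor hR (weightThreshold w D) (treeLabel v ω D s) = b then v s else 0)) ∈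
      (2 * D + 2 : ℝ) • B := by
  have ha := color_sum_sub_mem hB hsym h0 hD hTD h hR hw ht a
  have hb := color_sum_sub_mem hB hsym h0 hD hTD h hR hw ht b
  have hwa := hw a
  have hwb := hw b
  have h1 := hB.smul_mem_smul hsym h0 (c := w b / (w a + w b))
    (d := w b / (w a + w b) * (2 * D + 2)) (by positivity)
    (by rw [abs_of_nonneg (by positivity)]) ha
  have h2 := hB.smul_mem_smul hsym h0 (c := w a / (w a + w b))
    (d := w a / (w a + w b) * (2 * D + 2)) (by positivity)
    (by rw [abs_of_nonneg (by positivity)]) hb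
  have h3 := hB.sub_mem_smul hsym h0 (by positivity) (by positivity) h1 h2
  convert h3 using 1
  · congr 1
    field_simp
    ring
  · ext i
    simp only [Pi.smul_apply, Pi.sub_apply, smul_eq_mul]
    field_simp
    ring

end Discrepancy

lemma Fin.sum_Iic_eq_sum_range {M : Type*} [AddCommMonoid M] {T : ℕ} (t : Fin T) (F : ℕ → M) :
    ∑ s ∈ Finset.Iic t, F s = ∑ s ∈ Finset.range (t + 1), F s := by
  rw [Nat.range_succ_eq_Iic, ← Fin.map_valEmbedding_Iic, Finset.sum_map]
  rfl

/-- A bound for the number of levels of the tree used for `T` vectors. -/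
lemma two_mul_clog_add_two_le {T : ℕ} (hT : 2 ≤ T) :
    (2 * Nat.clog 2 T + 2 : ℝ) ≤ 9 * Real.log T := by
  have h1 := Nat.pow_pred_clog_lt_self one_lt_two (by omega : 1 < T)
  have h2 : 0 < Nat.clog 2 T := Nat.clog_pos one_lt_two hT
  obtain ⟨d, hd⟩ : ∃ d, Nat.clog 2 T = d + 1 := ⟨Nat.clog 2 T - 1, by omega⟩
  rw [hd] at h1 ⊢
  have h3 : (2 : ℝ) ^ d ≤ T := by exact_mod_cast h1.le
  have h4 := Real.log_le_log (by positivity) h3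
  rw [Real.log_pow] at h4
  have h5 := Real.log_two_gt_d9
  have h6 : Real.log 2 ≤ Real.log T := Real.log_le_log (by norm_num) (by exact_mod_cast hT)
  have h7 : (d : ℝ) * 0.69 ≤ d * Real.log 2 := by gcongr; linarith
  push_cast
  linarith

lemma two_pow_clog_le {T : ℕ} (hT : 2 ≤ T) : 2 ^ Nat.clog 2 T ≤ 2 * T := by
  have h1 := Nat.pow_pred_clog_lt_self one_lt_two (by omega : 1 < T)
  have h2 : 0 < Nat.clog 2 T := Nat.clog_pos one_lt_two hT
  obtain ⟨d, hd⟩ : ∃ d, Nat.clog 2 T = d + 1 := ⟨Nat.clog 2 T - 1, by omega⟩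
  rw [hd] at h1 ⊢
  rw [pow_succ]
  simp at h1
  omega

lemma sixteen_mul_exp_neg_sq_le {T : ℕ} (hT : 2 ≤ T) :
    16 * Real.exp (-(5 + Real.log T) ^ 2) ≤ 1 / T := by
  have hT' : (2 : ℝ) ≤ T := by exact_mod_cast hT
  have hL : 0 ≤ Real.log T := Real.log_nonneg (by linarith)
  have h1 : Real.exp (-(5 + Real.log T) ^ 2) ≤ Real.exp (-4 - Real.log T) := by
    gcongr
    nlinarith
  have h2 : Real.exp (-4 - Real.log T) = (Real.exp 1 ^ 4)⁻¹ / T := by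
    rw [sub_eq_add_neg, Real.exp_add, Real.exp_neg (Real.log T), Real.exp_log (by linarith),
      Real.exp_neg, ← Real.exp_nat_mul]
    norm_num [div_eq_mul_inv]
  have h3 : (16 : ℝ) ≤ Real.exp 1 ^ 4 := by
    have : (2 : ℝ) ≤ Real.exp 1 := by linarith [Real.exp_one_gt_d9]
    calc (16 : ℝ) = 2 ^ 4 := by norm_num
      _ ≤ _ := by gcongr
  calc 16 * Real.exp (-(5 + Real.log T) ^ 2) ≤ Real.exp 1 ^ 4 * ((Real.exp 1 ^ 4)⁻¹ / T) := by
        rw [← h2]; gcongr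
    _ = 1 / T := by field_simp

lemma failure_bound {T : ℕ} (hT : 2 ≤ T) {γ : ENNReal}
    (hγ : γ ≤ ENNReal.ofReal (((T : ℝ) ^ 3)⁻¹)) :
    2 ^ Nat.clog 2 T * ((T + 1 : ℕ) * (ENNReal.ofReal (1 + 1 / T) ^ T * γ)) ≤
      ENNReal.ofReal (12 / T) := by
  have hT' : (2 : ℝ) ≤ T := by exact_mod_cast hT
  have h1 : ENNReal.ofReal (1 + 1 / T) ^ T ≤ ENNReal.ofReal 3 := by
    rw [← ENNReal.ofReal_pow (by positivity)]
    apply ENNReal.ofReal_le_ofReal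
    calc (1 + 1 / (T : ℝ)) ^ T ≤ Real.exp (1 / T) ^ T := by
          gcongr; rw [add_comm]; exact Real.add_one_le_exp _
      _ = Real.exp 1 := by rw [← Real.exp_nat_mul]; congr 1; field_simp
      _ ≤ 3 := by linarith [Real.exp_one_lt_d9]
  have h2 : (2 : ENNReal) ^ Nat.clog 2 T ≤ ENNReal.ofReal (2 * T) := by
    have : ((2 ^ Nat.clog 2 T : ℕ) : ENNReal) ≤ ((2 * T : ℕ) : ENNReal) := by
      exact_mod_cast two_pow_clog_le hT
    rw [show (2 * T : ℝ) = ((2 * T : ℕ) : ℝ) by push_cast; ring, ENNReal.ofReal_natCast]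
    simpa using this
  have h3 : ((T + 1 : ℕ) : ENNReal) = ENNReal.ofReal (T + 1) := by
    rw [← ENNReal.ofReal_natCast]; push_cast; rfl
  rw [h3]
  calc _ ≤ ENNReal.ofReal (2 * T) * (ENNReal.ofReal (T + 1) * (ENNReal.ofReal 3 *
        ENNReal.ofReal (((T : ℝ) ^ 3)⁻¹))) := by gcongr
    _ = ENNReal.ofReal (2 * T * ((T + 1) * (3 * ((T : ℝ) ^ 3)⁻¹))) := by
        rw [← ENNReal.ofReal_mul (by positivity), ← ENNReal.ofReal_mul (by positivity),
          ← ENNReal.ofReal_mul (by positivity)]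
    _ ≤ _ := by
        apply ENNReal.ofReal_le_ofReal
        rw [show 2 * (T : ℝ) * ((T + 1) * (3 * ((T : ℝ) ^ 3)⁻¹)) = (6 * (T + 1) / T) / T by
          field_simp; ring]
        gcongr
        rw [div_le_iff₀ (by linarith)]
        linarith

/-- An online coloring whose weighted discrepancies stay in a dilate of a symmetric convex set
with small Gaussian complement. -/
theorem exists_online_coloring {n T R : ℕ} (hT : 2 ≤ T) (hR : 0 < R) {w : Fin R → ℝ}
    (hw : ∀ i, 0 < w i) (p : Measure (Fin n → ℝ)) [IsProbabilityMeasure p]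
    (hp : ∀ᵐ v ∂p, v ⬝ᵥ v ≤ 1) {B : Set (Fin n → ℝ)} (hB : Convex ℝ B)
    (hsym : ∀ x ∈ B, -x ∈ B) (h0 : (0 : Fin n → ℝ) ∈ B) (hBm : MeasurableSet B)
    (hγ : stdGauss n Bᶜ ≤ ENNReal.ofReal (((T : ℝ) ^ 3)⁻¹)) {r : ℝ}
    (hr : 81 * Real.log T ^ 2 ≤ r) :
    ∃ col : (t : Fin T) → (Fin (t.1 + 1) → (Fin n → ℝ)) → (Fin (t.1 + 1) → ℝ) → Fin R,
      (∀ t, Measurable fun q : (Fin (t.1 + 1) → (Fin n → ℝ)) × (Fin (t.1 + 1) → ℝ) =>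
        col t q.1 q.2) ∧
      ((Measure.pi fun _ : Fin T => p).prod
          (Measure.pi fun _ : Fin T => volume.restrict (Set.Icc (0:ℝ) 1)))
        {ω : (Fin T → (Fin n → ℝ)) × (Fin T → ℝ) |
          ∀ t : Fin T, ∀ a b : Fin R,
            ((1 / w a + 1 / w b)⁻¹ •
                ((w a)⁻¹ • (∑ s ∈ Finset.Iic t,
                    if col s (fun j => ω.1 (Fin.castLE s.isLt j))
                        (fun j => ω.2 (Fin.castLE s.isLt j)) = a then ω.1 s else 0) -
                 (w b)⁻¹ • (∑ s ∈ Finset.Iic t,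
                    if col s (fun j => ω.1 (Fin.castLE s.isLt j))
                        (fun j => ω.2 (Fin.castLE s.isLt j)) = b then ω.1 s else 0)))
              ∈ r • B} ≥
        ENNReal.ofReal (1 - 12 / T) := by
  have hT' : (2 : ℝ) ≤ T := by exact_mod_cast hT
  have hL : Real.log 2 ≤ Real.log T := Real.log_le_log (by norm_num) hT'
  have hl2 := Real.log_two_gt_d9
  have hT0 : 0 < T := by omega
  set D := Nat.clog 2 T with hDdef
  have hD : 0 < D := Nat.clog_pos one_lt_two hT
  set σ := 5 + Real.log T with hσ
  have hσ1 : 1 ≤ σ := by linarith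
  have hσ0 : 0 < σ := by linarith
  obtain ⟨g, hg⟩ := exists_seed_map n T D
  have hbad := (prod_pi_not_treeGood_le hT0 hσ1 (sixteen_mul_exp_neg_sq_le hT) hBm p hp hg).trans
    (failure_bound hT hγ)
  refine ⟨fun t vs us => blockColor hR (weightThreshold w D)
    (treeLabel (extendZero (σ⁻¹ • vs)) (extendSeed (g (us 0))) D t), fun t => ?_, ?_⟩
  · have hv : Measurable fun q : (Fin (t.1 + 1) → (Fin n → ℝ)) × (Fin (t.1 + 1) → ℝ) =>
        extendZero (σ⁻¹ • q.1) :=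
      measurable_extendZero.comp (by fun_prop)
    have hs : Measurable fun q : (Fin (t.1 + 1) → (Fin n → ℝ)) × (Fin (t.1 + 1) → ℝ) =>
        extendSeed (g (q.2 0)) :=
      measurable_extendSeed.comp (hg.measurable.comp ((measurable_pi_apply _).comp measurable_snd))
    have h := (measurable_pi_apply (t : ℕ)).comp (hv.treeLabel hs D)
    exact (measurable_from_nat (f := blockColor hR (weightThreshold w D))).comp h
  · set μ := (Measure.pi fun _ : Fin T => p).prod (Measure.pi fun _ : Fin T => unifUnit) with hμ
    set G := {x : (Fin T → Fin n → ℝ) × (Fin T → ℝ) |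
      treeGood B T D (extendZero (σ⁻¹ • x.1)) (extendSeed (g (x.2 ⟨0, hT0⟩)))} with hG
    have hμG : ENNReal.ofReal (1 - 12 / T) ≤ μ G := by
      have h1 : (1 : ENNReal) ≤ μ G + μ Gᶜ := by
        rw [← measure_univ (μ := μ), ← Set.union_compl_self G]
        exact measure_union_le _ _
      rw [ENNReal.ofReal_sub _ (by positivity), ENNReal.ofReal_one, tsub_le_iff_right]
      refine h1.trans ?_
      gcongr
      exact hbad
    refine hμG.trans (measure_mono fun x hx t a b => ?_)
    have hx' : treeGood B T D (extendZero (σ⁻¹ • x.1)) (extendSeed (g (x.2 ⟨0, hT0⟩))) := hx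
    have hcol : ∀ s : Fin T, treeLabel (extendZero (σ⁻¹ • fun j => x.1 (Fin.castLE s.isLt j)))
        (extendSeed (g (x.2 (Fin.castLE s.isLt 0)))) D s =
        treeLabel (extendZero (σ⁻¹ • x.1)) (extendSeed (g (x.2 ⟨0, hT0⟩))) D s := by
      intro s
      refine treeLabel_congr _ D fun r hr => ?_
      rw [extendZero_of_lt _ (Nat.lt_succ_of_le hr), extendZero_of_lt _ (hr.trans_lt s.2)]
      rfl
    have hsum : ∀ c : Fin R, (∑ s ∈ Finset.Iic t, if blockColor hR (weightThreshold w D)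
        (treeLabel (extendZero (σ⁻¹ • fun j => x.1 (Fin.castLE s.isLt j)))
          (extendSeed (g (x.2 (Fin.castLE s.isLt 0)))) D s) = c then x.1 s else 0) =
        σ • ∑ s ∈ Finset.range (t + 1), if blockColor hR (weightThreshold w D)
          (treeLabel (extendZero (σ⁻¹ • x.1)) (extendSeed (g (x.2 ⟨0, hT0⟩))) D s) = c then
          extendZero (σ⁻¹ • x.1) s else 0 := by
      intro c
      rw [← Fin.sum_Iic_eq_sum_range, Finset.smul_sum]
      refine Finset.sum_congr rfl fun s _ => ?_
      rw [hcol, extendZero_of_lt _ s.2]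
      split_ifs
      · simp [smul_smul, hσ0.ne']
      · simp
    have h1 := weighted_discrepancy_mem hB hsym h0 hD (Nat.le_pow_clog one_lt_two T) hx' hR hw
      (t := t + 1) t.2 a b
    have h2 := hB.smul_mem_smul hsym h0 (c := σ) (d := r) (by positivity) (by
      rw [abs_of_pos hσ0]
      refine le_trans ?_ hr
      have := two_mul_clog_add_two_le hT
      calc σ * (2 * D + 2 : ℝ) ≤ (9 * Real.log T) * (9 * Real.log T) := by
            gcongr
            linarith
        _ = _ := by ring) h1
    rw [hsum a, hsum b]
    convert h2 using 1
    ext i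
    simp only [Pi.smul_apply, Pi.sub_apply, smul_eq_mul]
    ring

section GaussianTails

open ProbabilityTheory

lemma hasSubgaussianMGF_const_mul_eval {n : ℕ} (z : Fin n → ℝ) (i : Fin n) :
    HasSubgaussianMGF (fun x : Fin n → ℝ => z i * x i) (z i ^ 2).toNNReal
      (stdGauss n) := by
  have h1 : HasSubgaussianMGF (fun x : Fin n → ℝ => x i) 1 (stdGauss n) := by
    have hm : AEMeasurable (fun x : Fin n → ℝ => x i) (stdGauss n) :=
      (measurable_pi_apply i).aemeasurable
    have hmap : (stdGauss n).map (fun x : Fin n → ℝ => x i) = gaussianReal 0 1 :=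
      (measurePreserving_eval (fun _ : Fin n => gaussianReal 0 1) i).map_eq
    refine (HasSubgaussianMGF.id_map_iff hm).1 ?_
    rw [hmap]
    exact ⟨fun t => integrable_exp_mul_gaussianReal t, fun t => by
      rw [mgf_id_gaussianReal]; simp⟩
  convert h1.const_mul (z i) using 1
  ext
  rw [Real.coe_toNNReal _ (sq_nonneg (z i))]
  exact (mul_one (z i ^ 2)).symm

lemma hasSubgaussianMGF_dotProduct {n : ℕ} (z : Fin n → ℝ) :
    HasSubgaussianMGF (fun x : Fin n → ℝ => x ⬝ᵥ z)
      (∑ i, (z i ^ 2).toNNReal) (stdGauss n) := by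
  have hind : iIndepFun (fun i (x : Fin n → ℝ) => z i * x i) (stdGauss n) :=
    iIndepFun_pi (μ := fun _ : Fin n => gaussianReal 0 1) (X := fun i (y : ℝ) => z i * y)
      fun i => by fun_prop
  have := HasSubgaussianMGF.sum_of_iIndepFun hind (s := Finset.univ)
    fun i _ => hasSubgaussianMGF_const_mul_eval z i
  simpa [dotProduct, mul_comm] using this

lemma stdGauss_dotProduct_ge_le {n : ℕ} {z : Fin n → ℝ} (hz : z ⬝ᵥ z ≤ 1) {ρ : ℝ} (hρ : 0 ≤ ρ) :
    stdGauss n {x | ρ ≤ x ⬝ᵥ z} ≤ ENNReal.ofReal (Real.exp (-ρ ^ 2 / 2)) := by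
  have h := (hasSubgaussianMGF_dotProduct z).measure_ge_le hρ
  rw [← ofReal_measureReal]
  apply ENNReal.ofReal_le_ofReal
  have hc : ((∑ i, (z i ^ 2).toNNReal : NNReal) : ℝ) = z ⬝ᵥ z := by
    rw [NNReal.coe_sum]
    exact Finset.sum_congr rfl fun i _ => by rw [Real.coe_toNNReal _ (sq_nonneg _), sq]
  rw [hc] at h
  rcases (show 0 ≤ z ⬝ᵥ z from hc ▸ NNReal.coe_nonneg _).eq_or_lt with h0 | h0
  · have hz0 : z = 0 := dotProduct_self_eq_zero.1 h0.symm
    subst hz0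
    rcases hρ.eq_or_lt with h1 | h1
    · simp [← h1]
    · simp [h1.not_ge, Real.exp_nonneg]
  · refine h.trans (Real.exp_le_exp.2 ?_)
    rw [neg_div, neg_div, neg_le_neg_iff]
    gcongr
    linarith

/-- The Gaussian measure of the complement of an intersection of slabs. -/
lemma stdGauss_compl_slabs_le {n : ℕ} (S : Finset (Fin n → ℝ)) (hS : ∀ z ∈ S, z ⬝ᵥ z ≤ 1) {ρ : ℝ}
    (hρ : 0 ≤ ρ) : stdGauss n {x | ∀ z ∈ S, |x ⬝ᵥ z| ≤ ρ}ᶜ ≤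
      ENNReal.ofReal (2 * S.card * Real.exp (-ρ ^ 2 / 2)) := by
  have hsub : {x : Fin n → ℝ | ∀ z ∈ S, |x ⬝ᵥ z| ≤ ρ}ᶜ ⊆
      ⋃ z ∈ S, ({x | ρ ≤ x ⬝ᵥ z} ∪ {x | ρ ≤ x ⬝ᵥ (-z)}) := by
    intro x hx
    simp only [Set.mem_compl_iff, Set.mem_ofPred_eq, not_forall, not_le] at hx
    obtain ⟨z, hz, h⟩ := hx
    refine Set.mem_biUnion (x := z) hz ?_
    rcases lt_abs.1 h with h | h
    · exact Or.inl h.le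
    · exact Or.inr (by simpa using h.le)
  calc _ ≤ ∑ z ∈ S, stdGauss n ({x | ρ ≤ x ⬝ᵥ z} ∪ {x | ρ ≤ x ⬝ᵥ (-z)}) :=
        (measure_mono hsub).trans (measure_biUnion_finset_le _ _)
    _ ≤ ∑ z ∈ S, ENNReal.ofReal (2 * Real.exp (-ρ ^ 2 / 2)) := by
        refine Finset.sum_le_sum fun z hz => (measure_union_le _ _).trans ?_
        rw [two_mul, ENNReal.ofReal_add (Real.exp_nonneg _) (Real.exp_nonneg _)]
        exact add_le_add (stdGauss_dotProduct_ge_le (hS z hz) hρ)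
          (stdGauss_dotProduct_ge_le (by simpa using hS z hz) hρ)
    _ = _ := by
        rw [Finset.sum_const, nsmul_eq_mul, ← ENNReal.ofReal_natCast,
          ← ENNReal.ofReal_mul (by positivity)]
        congr 1
        ring

lemma isGaussian_stdGauss (n : ℕ) : IsGaussian (stdGauss n) := by
  have hind : iIndepFun (fun i (x : Fin n → ℝ) => x i) (stdGauss n) :=
    iIndepFun_pi (μ := fun _ : Fin n => gaussianReal 0 1) (X := fun i (y : ℝ) => y)
      fun i => by fun_prop
  have h := iIndepFun.hasGaussianLaw (fun i => ⟨by
    have := (measurePreserving_eval (fun _ : Fin n => gaussianReal 0 1) i).map_eq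
    change IsGaussian ((stdGauss n).map (Function.eval i))
    rw [stdGauss, this]
    infer_instance⟩) hind
  simpa using h.isGaussian_map

lemma integral_id_stdGauss (n : ℕ) : (stdGauss n)[id] = 0 := by
  have := isGaussian_stdGauss n
  ext i
  rw [eval_integral fun i => ?_]
  · simpa [stdGauss] using integral_eval (μ := fun _ : Fin n => gaussianReal 0 1) (i := i)
  · exact integrable_eval IsGaussian.integrable_id

lemma map_rotation_stdGauss (n : ℕ) (θ : ℝ) :
    ((stdGauss n).prod (stdGauss n)).map (ContinuousLinearMap.rotation θ) =
      (stdGauss n).prod (stdGauss n) := by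
  have := isGaussian_stdGauss n
  exact IsGaussian.map_rotation_eq_self (integral_id_stdGauss n) θ

end GaussianTails

section ConvexConcentration

variable {n : ℕ} {K : Set (Fin n → ℝ)}

/-- The rotation by `π / 4` maps points with exactly one coordinate in `K` and the other
outside `4 b K` to pairs lying outside `b K`. -/
lemma two_mul_stdGauss_mul_stdGauss_compl_le (hK : Convex ℝ K) (hKc : IsClosed K)
    (hsym : ∀ x ∈ K, -x ∈ K) (h0 : (0 : Fin n → ℝ) ∈ K) {b : ℝ} (hb : 1 ≤ b) :
    2 * (stdGauss n K * stdGauss n ((4 * b) • K)ᶜ) ≤ stdGauss n (b • K)ᶜ ^ 2 := by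
  have hclosed : ∀ c : ℝ, c ≠ 0 → MeasurableSet (c • K) := fun c hc =>
    (hKc.smul₀ c).measurableSet
  have hmb := (hclosed b (by positivity)).compl
  have hm4 := (hclosed (4 * b) (by positivity)).compl
  have hsq : Real.sqrt 2 ^ 2 = 2 := Real.sq_sqrt (by norm_num)
  have hs2 : Real.sqrt 2 ≤ 3 / 2 := by
    rw [Real.sqrt_le_left (by norm_num)]; norm_num
  have hmono : K ⊆ (4 * b) • K := fun x hx => by
    refine hK.mem_smul_mono hsym h0 zero_le_one (by linarith) ?_
    rwa [one_smul]
  have key : ∀ x ∈ K, ∀ y : Fin n → ℝ, ∀ c : ℝ, |c| = 1 → y ∉ (4 * b) • K →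
      (√2 / 2) • (c • x + y) ∉ b • K := by
    intro x hx y c hc hy hmem
    apply hy
    have h1 : c • x + y ∈ (√2 * b) • K := by
      have := hK.smul_mem_smul hsym h0 (c := √2) (d := √2 * b) (by linarith)
        (by rw [abs_of_nonneg (Real.sqrt_nonneg _)]) hmem
      rwa [smul_smul, show √2 * (√2 / 2) = 1 by nlinarith, one_smul] at this
    have h2 : c • x ∈ (1 : ℝ) • K :=
      hK.smul_mem_smul hsym h0 (r := 1) zero_le_one (by rw [hc, mul_one]) (by rwa [one_smul])
    have h3 := hK.sub_mem_smul hsym h0 (by positivity) zero_le_one h1 h2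
    rw [add_sub_cancel_left] at h3
    exact hK.mem_smul_mono hsym h0 (by positivity) (by nlinarith) h3
  set L := ContinuousLinearMap.rotation (E := Fin n → ℝ) (-(π / 4)) with hL
  have hLapp : ∀ x y : Fin n → ℝ,
      L (x, y) = ((√2 / 2) • x - (√2 / 2) • y, (√2 / 2) • x + (√2 / 2) • y) := by
    intro x y
    simp [hL, ContinuousLinearMap.rotation_apply, Real.cos_pi_div_four, Real.sin_pi_div_four,
      sub_eq_add_neg]
  have hsub : K ×ˢ ((4 * b) • K)ᶜ ∪ ((4 * b) • K)ᶜ ×ˢ K ⊆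
      L ⁻¹' ((b • K)ᶜ ×ˢ (b • K)ᶜ) := by
    rintro ⟨x, y⟩ (⟨hx, hy⟩ | ⟨hx, hy⟩)
    · rw [Set.mem_preimage, hLapp]
      constructor
      · intro h
        have h' : -((√2 / 2) • x - (√2 / 2) • y) ∈ b • K := by
          have := hK.smul_mem_smul hsym h0 (c := -1) (d := b) (by linarith) (by simp) h
          simpa using this
        refine key x hx y (-1) (by simp) hy ?_
        convert h' using 1
        module
      · intro h
        refine key x hx y 1 (by simp) hy ?_
        convert h using 1
        module
    · rw [Set.mem_preimage, hLapp]
      constructor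
      · intro h
        refine key y hy x (-1) (by simp) hx ?_
        convert h using 1
        module
      · intro h
        refine key y hy x 1 (by simp) hx ?_
        convert h using 1
        module
  have hdisj : Disjoint (K ×ˢ ((4 * b) • K)ᶜ) (((4 * b) • K)ᶜ ×ˢ K) :=
    Set.disjoint_left.2 fun q h1 h2 => h2.1 (hmono h1.1)
  calc 2 * (stdGauss n K * stdGauss n ((4 * b) • K)ᶜ)
      = ((stdGauss n).prod (stdGauss n)) (K ×ˢ ((4 * b) • K)ᶜ ∪ ((4 * b) • K)ᶜ ×ˢ K) := by
        rw [measure_union hdisj (hm4.prod hKc.measurableSet), Measure.prod_prod,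
          Measure.prod_prod, two_mul, mul_comm (stdGauss n ((4 * b) • K)ᶜ)]
    _ ≤ ((stdGauss n).prod (stdGauss n)) (L ⁻¹' ((b • K)ᶜ ×ˢ (b • K)ᶜ)) := measure_mono hsub
    _ = stdGauss n (b • K)ᶜ ^ 2 := by
        rw [← Measure.map_apply L.continuous.measurable (hmb.prod hmb), map_rotation_stdGauss,
          Measure.prod_prod, sq]

lemma stdGauss_compl_pow_smul_le (hK : Convex ℝ K) (hKc : IsClosed K)
    (hsym : ∀ x ∈ K, -x ∈ K) (h0 : (0 : Fin n → ℝ) ∈ K) (hγ : 1 / 2 ≤ stdGauss n K) (m : ℕ) :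
    stdGauss n ((4 : ℝ) ^ m • K)ᶜ ≤ (1 / 2) ^ 2 ^ m := by
  induction m with
  | zero =>
    rw [pow_zero, pow_zero, one_smul, pow_one, prob_compl_eq_one_sub hKc.measurableSet]
    refine (tsub_le_tsub_left hγ 1).trans ?_
    rw [one_div, ENNReal.one_sub_inv_two]
  | succ m ih =>
    have h := two_mul_stdGauss_mul_stdGauss_compl_le hK hKc hsym h0
      (b := 4 ^ m) (one_le_pow₀ (by norm_num))
    calc stdGauss n ((4 : ℝ) ^ (m + 1) • K)ᶜ
        = 2 * (1 / 2 * stdGauss n ((4 * (4 : ℝ) ^ m) • K)ᶜ) := by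
          rw [← mul_assoc, one_div, ENNReal.mul_inv_cancel two_ne_zero ENNReal.ofNat_ne_top,
            one_mul, pow_succ' (4 : ℝ)]
      _ ≤ 2 * (stdGauss n K * stdGauss n ((4 * (4 : ℝ) ^ m) • K)ᶜ) := by gcongr
      _ ≤ stdGauss n ((4 : ℝ) ^ m • K)ᶜ ^ 2 := h
      _ ≤ ((1 / 2) ^ 2 ^ m) ^ 2 := by gcongr
      _ = _ := by rw [← pow_mul, ← pow_succ]

/-- A symmetric convex set of Gaussian measure at least `1 / 2` has, after dilation by a factor
of order `(log T) ^ 2`, complement of Gaussian measure at most `T ^ (-3)`. -/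
lemma exists_dilation_stdGauss_compl_le (hK : Convex ℝ K) (hKc : IsClosed K)
    (hsym : ∀ x ∈ K, -x ∈ K) (h0 : (0 : Fin n → ℝ) ∈ K) (hγ : 1 / 2 ≤ stdGauss n K)
    {T : ℕ} (hT : 2 ≤ T) : ∃ d : ℝ, 1 ≤ d ∧ d ≤ 729 * Real.log T ^ 2 ∧
      stdGauss n (d • K)ᶜ ≤ ENNReal.ofReal (((T : ℝ) ^ 3)⁻¹) := by
  set D := Nat.clog 2 T with hD
  have hD1 : 1 ≤ D := Nat.clog_pos one_lt_two hT
  have hT0 : (0 : ℝ) < T := by positivity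
  have hTD : T ≤ 2 ^ D := Nat.le_pow_clog one_lt_two T
  have hm1 : 3 * D ≤ 2 ^ Nat.clog 2 (3 * D) := Nat.le_pow_clog one_lt_two _
  have hm2 : 2 ^ Nat.clog 2 (3 * D) ≤ 2 * (3 * D) := two_pow_clog_le (by lia)
  set m := Nat.clog 2 (3 * D)
  have hL : (2 * D + 2 : ℝ) ≤ 9 * Real.log T := two_mul_clog_add_two_le hT
  refine ⟨4 ^ m, one_le_pow₀ (by norm_num), ?_,
    (stdGauss_compl_pow_smul_le hK hKc hsym h0 hγ m).trans ?_⟩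
  · have h2 : (2 : ℝ) ^ m ≤ 6 * D := by
      have : ((2 ^ m : ℕ) : ℝ) ≤ ((2 * (3 * D) : ℕ) : ℝ) := by exact_mod_cast hm2
      push_cast at this
      linarith
    have hD0 : (0 : ℝ) ≤ D := by positivity
    calc (4 : ℝ) ^ m = (2 ^ m) ^ 2 := by
          rw [← pow_mul, mul_comm, pow_mul]; norm_num
      _ ≤ (27 * Real.log T) ^ 2 := by
          gcongr
          linarith
      _ = _ := by ring
  · have h : (1 / 2 : ENNReal) ^ 2 ^ m = ENNReal.ofReal ((1 / 2) ^ 2 ^ m) := by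
      rw [ENNReal.ofReal_pow (by norm_num)]
      congr 1
      rw [one_div, one_div, ENNReal.ofReal_inv_of_pos two_pos]
      simp
    rw [h]
    apply ENNReal.ofReal_le_ofReal
    calc ((1 : ℝ) / 2) ^ 2 ^ m ≤ (1 / 2) ^ (3 * D) :=
          pow_le_pow_of_le_one (by norm_num) (by norm_num) hm1
      _ = ((2 ^ D) ^ 3)⁻¹ := by rw [one_div, inv_pow, mul_comm, pow_mul]
      _ ≤ _ := by
          gcongr
          exact_mod_cast hTD

end ConvexConcentration

lemma two_mul_card_mul_exp_neg_le {n T m : ℕ} (hn : 2 ≤ n) (hT : 2 ≤ T) {C₀ : ℝ} (hC₀ : 0 < C₀)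
    (hm : (m : ℝ) ≤ ((n : ℝ) * T) ^ C₀) :
    2 * m * Real.exp (-((8 + 2 * C₀) * Real.log (n * T)) ^ 2 / 2) ≤ ((T : ℝ) ^ 3)⁻¹ := by
  have hn' : (2 : ℝ) ≤ n := by exact_mod_cast hn
  have hT' : (2 : ℝ) ≤ T := by exact_mod_cast hT
  have hnT : (0 : ℝ) < n * T := by positivity
  set l := Real.log (n * T) with hl
  have hl2 : Real.log 2 ≤ l := Real.log_le_log (by norm_num) (by nlinarith)
  have hlT : Real.log T ≤ l := Real.log_le_log (by positivity) (by nlinarith)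
  have hlog2 := Real.log_two_gt_d9
  have h2 : (2 : ℝ) ≤ Real.exp l := by
    rw [← Real.log_le_iff_le_exp (by norm_num)]
    exact hl2
  have hm' : (m : ℝ) ≤ Real.exp (l * C₀) := by
    rwa [Real.rpow_def_of_pos hnT] at hm
  have hT3 : ((T : ℝ) ^ 3)⁻¹ = Real.exp (-(3 * Real.log T)) := by
    rw [Real.exp_neg, mul_comm, Real.exp_mul, Real.exp_log (by positivity)]
    norm_cast
  rw [hT3]
  calc _ ≤ Real.exp l * Real.exp (l * C₀) *
        Real.exp (-((8 + 2 * C₀) * l) ^ 2 / 2) := by gcongr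
    _ = Real.exp (l + l * C₀ + -((8 + 2 * C₀) * l) ^ 2 / 2) := by
        rw [Real.exp_add, Real.exp_add]
    _ ≤ _ := by
        apply Real.exp_le_exp.2
        have h1 : 1 ≤ (8 + 2 * C₀) * l := by nlinarith
        nlinarith

lemma convex_slabs {n : ℕ} (S : Finset (Fin n → ℝ)) (ρ : ℝ) :
    Convex ℝ {x : Fin n → ℝ | ∀ z ∈ S, |x ⬝ᵥ z| ≤ ρ} := by
  intro x hx y hy a b ha hb hab z hz
  rw [add_dotProduct, smul_dotProduct, smul_dotProduct, smul_eq_mul, smul_eq_mul]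
  calc |a * (x ⬝ᵥ z) + b * (y ⬝ᵥ z)| ≤ a * |x ⬝ᵥ z| + b * |y ⬝ᵥ z| := by
        refine (abs_add_le _ _).trans_eq ?_
        rw [abs_mul, abs_mul, abs_of_nonneg ha, abs_of_nonneg hb]
    _ ≤ a * ρ + b * ρ := by
        gcongr
        exacts [hx z hz, hy z hz]
    _ = ρ := by rw [← add_mul, hab, one_mul]

lemma measurableSet_slabs {n : ℕ} (S : Finset (Fin n → ℝ)) (ρ : ℝ) :
    MeasurableSet {x : Fin n → ℝ | ∀ z ∈ S, |x ⬝ᵥ z| ≤ ρ} := by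
  have h : {x : Fin n → ℝ | ∀ z ∈ S, |x ⬝ᵥ z| ≤ ρ} = ⋂ z ∈ S, {x | |x ⬝ᵥ z| ≤ ρ} := by
    ext; simp
  rw [h]
  refine Finset.measurableSet_biInter _ fun z _ => measurableSet_le ?_ measurable_const
  simp only [dotProduct]
  fun_prop

lemma sqrt_sum_sq_le_one_iff {n : ℕ} (v : Fin n → ℝ) :
    Real.sqrt (∑ i, v i ^ 2) ≤ 1 ↔ v ⬝ᵥ v ≤ 1 := by
  rw [Real.sqrt_le_one, dotProduct]
  simp only [sq]

lemma zero_mem_of_convex_of_neg {E : Type*} [AddCommGroup E] [Module ℝ E] {K : Set E}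
    (hK : Convex ℝ K) (hsym : ∀ x ∈ K, -x ∈ K) (hne : K.Nonempty) : (0 : E) ∈ K := by
  obtain ⟨x, hx⟩ := hne
  convert hK hx (hsym x hx) (a := 1 / 2) (b := 1 / 2) (by norm_num) (by norm_num)
    (by norm_num) using 1
  module

/-- **Online weighted multi-color discrepancy** (Theorem 1.5).  For every `C₀ > 0` and `c > 0`
there is `C > 0` such that for all `n, T, R ≥ 2`, `η ≥ 1`, weights `w₁,…,w_R ∈ [1,η]` and every
probability distribution `p` on `ℝ^n` supported on the unit ball: (1) for every test set `S`
of at most `(nT)^{C₀}` vectors of norm at most `1` there is an online coloring algorithm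
keeping the weighted pairwise discrepancy (in the norm `max_{z∈S}|⟨·,z⟩|`) at most
`C (log (Rη))² (log (nT))⁴` with probability `1 - C/T`; and (2) if moreover `p` has
sub-exponential tails with constant `c` and `K` is a symmetric convex body of Gaussian
measure at least `1/2`, the same holds for the norm with unit ball `K`, with bound
`C (log (Rη))² (log (nT))⁵`. -/
theorem online_multicolor_discrepancy :
    ∀ C₀ c : ℝ, 0 < C₀ → 0 < c →
    ∃ C : ℝ, 0 < C ∧
      ∀ (n T R : ℕ), 2 ≤ n → 2 ≤ T → 2 ≤ R →
      ∀ η : ℝ, 1 ≤ η →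
      ∀ w : Fin R → ℝ, (∀ i, w i ∈ Set.Icc 1 η) →
      ∀ (p : Measure (Fin n → ℝ)) [IsProbabilityMeasure p],
      (∀ᵐ v ∂p, Real.sqrt (∑ i, v i ^ 2) ≤ 1) →
      -- (1) arbitrary polynomial-size test sets
      ((∀ (S : Finset (Fin n → ℝ)), S.Nonempty →
          (S.card : ℝ) ≤ ((n : ℝ) * T) ^ C₀ →
          (∀ z ∈ S, Real.sqrt (∑ i, z i ^ 2) ≤ 1) →
        ∃ col : (t : Fin T) → (Fin (t.1 + 1) → (Fin n → ℝ)) → (Fin (t.1 + 1) → ℝ) → Fin R,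
          (∀ t, Measurable fun q : (Fin (t.1 + 1) → (Fin n → ℝ)) × (Fin (t.1 + 1) → ℝ) =>
              col t q.1 q.2) ∧
          ((Measure.pi fun _ : Fin T => p).prod
              (Measure.pi fun _ : Fin T => volume.restrict (Set.Icc (0:ℝ) 1)))
            {ω : (Fin T → (Fin n → ℝ)) × (Fin T → ℝ) |
              ∀ t : Fin T, ∀ a b : Fin R, a ≠ b → ∀ z ∈ S,
                |∑ i, ((1 / w a + 1 / w b)⁻¹ •
                    ((w a)⁻¹ • (∑ s ∈ Finset.Iic t,
                        if col s (fun j => ω.1 (Fin.castLE s.isLt j))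
                            (fun j => ω.2 (Fin.castLE s.isLt j)) = a then ω.1 s else 0) -
                     (w b)⁻¹ • (∑ s ∈ Finset.Iic t,
                        if col s (fun j => ω.1 (Fin.castLE s.isLt j))
                            (fun j => ω.2 (Fin.castLE s.isLt j)) = b then ω.1 s else 0))) i * z i|
                  ≤ C * Real.log ((R : ℝ) * η) ^ 2 * Real.log ((n : ℝ) * T) ^ 4 } ≥
            ENNReal.ofReal (1 - C / T)) ∧
      -- (2) arbitrary convex-body norms, under sub-exponential tails
       ((∀ θ : Fin n → ℝ, Real.sqrt (∑ i, θ i ^ 2) = 1 → ∀ r : ℝ, 0 < r →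
          p {v | r * Real.sqrt (∫ u, (∑ i, u i * θ i - ∫ u', ∑ i, u' i * θ i ∂p) ^ 2 ∂p)
                ≤ |∑ i, v i * θ i - ∫ u', ∑ i, u' i * θ i ∂p|}
            ≤ ENNReal.ofReal (2 * Real.exp (-c * r))) →
        ∀ K : Set (Fin n → ℝ),
          IsCompact K → Convex ℝ K → (interior K).Nonempty → K = -K →
          (volume.withDensity fun x : Fin n → ℝ =>
              ENNReal.ofReal ((2 * Real.pi) ^ (-(n : ℝ) / 2) * Real.exp (-(∑ i, x i ^ 2) / 2))) K
            ≥ 1 / 2 →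
        ∃ col : (t : Fin T) → (Fin (t.1 + 1) → (Fin n → ℝ)) → (Fin (t.1 + 1) → ℝ) → Fin R,
          (∀ t, Measurable fun q : (Fin (t.1 + 1) → (Fin n → ℝ)) × (Fin (t.1 + 1) → ℝ) =>
              col t q.1 q.2) ∧
          ((Measure.pi fun _ : Fin T => p).prod
              (Measure.pi fun _ : Fin T => volume.restrict (Set.Icc (0:ℝ) 1)))
            {ω : (Fin T → (Fin n → ℝ)) × (Fin T → ℝ) |
              ∀ t : Fin T, ∀ a b : Fin R, a ≠ b →
                ((1 / w a + 1 / w b)⁻¹ •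
                    ((w a)⁻¹ • (∑ s ∈ Finset.Iic t,
                        if col s (fun j => ω.1 (Fin.castLE s.isLt j))
                            (fun j => ω.2 (Fin.castLE s.isLt j)) = a then ω.1 s else 0) -
                     (w b)⁻¹ • (∑ s ∈ Finset.Iic t,
                        if col s (fun j => ω.1 (Fin.castLE s.isLt j))
                            (fun j => ω.2 (Fin.castLE s.isLt j)) = b then ω.1 s else 0)))
                  ∈ (C * Real.log ((R : ℝ) * η) ^ 2 * Real.log ((n : ℝ) * T) ^ 5) • K } ≥
            ENNReal.ofReal (1 - C / T))) := by
  intro C₀ c hC₀ _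
  refine ⟨177147 + 243 * (8 + 2 * C₀), by positivity, ?_⟩
  intro n T R hn hT hR η hη w hw p _ hp
  set C := 177147 + 243 * (8 + 2 * C₀) with hC
  have hn' : (2 : ℝ) ≤ n := by exact_mod_cast hn
  have hT' : (2 : ℝ) ≤ T := by exact_mod_cast hT
  have hR' : (2 : ℝ) ≤ R := by exact_mod_cast hR
  have hlog2 := Real.log_two_gt_d9
  have hlR : Real.log 2 ≤ Real.log (R * η) := Real.log_le_log (by norm_num) (by nlinarith)
  have hlT0 : 0 ≤ Real.log T := Real.log_nonneg (by linarith)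
  have hlT : Real.log T ≤ Real.log (n * T) := Real.log_le_log (by positivity) (by nlinarith)
  have hl4 : 1 ≤ Real.log (n * T) := by
    have h : 2 * Real.log 2 ≤ Real.log (n * T) := by
      rw [Real.log_mul (by positivity) (by positivity), two_mul]
      exact add_le_add (Real.log_le_log (by norm_num) hn') (Real.log_le_log (by norm_num) hT')
    linarith
  have hlR2 : 1 / 3 ≤ Real.log (R * η) ^ 2 := by nlinarith
  have hw0 : ∀ i, 0 < w i := fun i => zero_lt_one.trans_le (hw i).1
  have hp' : ∀ᵐ v ∂p, v ⬝ᵥ v ≤ 1 := by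
    filter_upwards [hp] with v hv using (sqrt_sum_sq_le_one_iff v).1 hv
  have hprob : ENNReal.ofReal (1 - C / T) ≤ ENNReal.ofReal (1 - 12 / T) := by
    apply ENNReal.ofReal_le_ofReal
    gcongr
    linarith
  constructor
  · intro S _ hcard hS
    set ρ := (8 + 2 * C₀) * Real.log (n * T) with hρ
    have hρ0 : 0 ≤ ρ := by positivity
    have hγ := (stdGauss_compl_slabs_le S (fun z hz => (sqrt_sum_sq_le_one_iff z).1 (hS z hz))
      hρ0).trans (ENNReal.ofReal_le_ofReal (two_mul_card_mul_exp_neg_le hn hT hC₀ hcard))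
    obtain ⟨col, hcol, hμ⟩ := exists_online_coloring hT (by lia) hw0 p hp' (convex_slabs S ρ)
      (fun x hx z hz => by simpa using hx z hz) (fun z _ => by simpa using hρ0)
      (measurableSet_slabs S ρ) hγ le_rfl
    refine ⟨col, hcol, hprob.trans (hμ.trans (measure_mono ?_))⟩
    intro ω hω t a b _ z hz
    obtain ⟨y, hy, hyx⟩ := hω t a b
    rw [← hyx]
    change |((81 * Real.log T ^ 2) • y) ⬝ᵥ z| ≤ _
    rw [smul_dotProduct, smul_eq_mul, abs_mul, abs_of_nonneg (by positivity)]
    calc 81 * Real.log T ^ 2 * |y ⬝ᵥ z| ≤ 81 * Real.log (n * T) ^ 2 * ρ := by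
          gcongr
          exact hy z hz
      _ = (243 * (8 + 2 * C₀)) * (1 / 3) * Real.log (n * T) ^ 3 := by rw [hρ]; ring
      _ ≤ C * Real.log (R * η) ^ 2 * Real.log (n * T) ^ 4 := by
          gcongr
          · rw [hC]; linarith
          · norm_num
  · intro _ K hKcomp hK hKint hKsym hKγ
    have hsym : ∀ x ∈ K, -x ∈ K := fun x hx => by
      rw [hKsym] at hx
      exact hx
    have h0 := zero_mem_of_convex_of_neg hK hsym (hKint.mono interior_subset)
    have hKγ' : 1 / 2 ≤ stdGauss n K := by
      rw [stdGauss_eq_withDensity]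
      exact hKγ
    obtain ⟨d, hd1, hd, hγ⟩ :=
      exists_dilation_stdGauss_compl_le hK hKcomp.isClosed hsym h0 hKγ' hT
    obtain ⟨col, hcol, hμ⟩ := exists_online_coloring hT (by lia) hw0 p hp' (hK.smul d)
      (fun x hx => by
        obtain ⟨y, hy, rfl⟩ := hx
        exact ⟨-y, hsym y hy, smul_neg d y⟩)
      ⟨0, h0, smul_zero d⟩ (hKcomp.smul d).isClosed.measurableSet hγ le_rfl
    refine ⟨col, hcol, hprob.trans (hμ.trans (measure_mono ?_))⟩
    intro ω hω t a b _
    have h := hω t a b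
    rw [smul_smul] at h
    refine hK.mem_smul_mono hsym h0 (by positivity) ?_ h
    calc 81 * Real.log T ^ 2 * d ≤ 81 * Real.log T ^ 2 * (729 * Real.log T ^ 2) := by gcongr
      _ = 177147 * (1 / 3) * Real.log T ^ 4 := by ring
      _ ≤ C * Real.log (R * η) ^ 2 * Real.log (n * T) ^ 4 := by
          gcongr
          rw [hC]; linarith
      _ ≤ C * Real.log (R * η) ^ 2 * Real.log (n * T) ^ 5 := by
          gcongr
          norm_num
end

section
/- Let n, T ≥ 2 be integers, κ = 8⌈log(nT)⌉, and let Σ be a positive semidefinite n×n matrix with Σ ⪯ I, with spectral decomposition Σ = Σ_i σ_i u_i u_i^⊤ for an orthonormal basis u_1,…,u_n. Then there exists a positive semidefinite matrix M with the same eigenvectors u_1,…,u_n, satisfying ‖M‖_op ≤ 1 and ‖M^+‖_op ≤ 2 (M^+ the Moore–Penrose pseudo-inverse), such that: (i) the matrix MΣM is κ-dyadic, i.e. every nonzero eigenvalue of MΣM equals 2^{−k} for some k ∈ {1,…,κ}; and (ii) letting Π_err be the orthogonal projection onto the span of those u_i with σ_i ≤ 2^{−κ}, for every finite set S ⊂ ℝ^n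 of vectors of Euclidean norm at most nT, the set S' = {(1/2)M^+ y : y ∈ S} consists of vectors of Euclidean norm at most max_{y∈S}‖y‖_2, and for every d ∈ ℝ^n, max_{y∈S} |⟨d,y⟩| ≤ 2·max_{z∈S'} |⟨Md,z⟩| + nT·‖Π_err d‖_2. -/
open Real Matrix

/-- Euclidean norm of a vector in `ℝ^n`. -/
noncomputable def euclNorm {n : ℕ} (x : Fin n → ℝ) : ℝ := Real.sqrt (∑ i, x i ^ 2)

/-- Standard inner product on `ℝ^n`. -/
noncomputable def euclDot {n : ℕ} (x y : Fin n → ℝ) : ℝ := ∑ i, x i * y i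

/-- The matrix with eigenvector matrix `U` and eigenvalues `f`. -/
noncomputable def spectralMat {n : ℕ} (U : Matrix (Fin n) (Fin n) ℝ) (f : Fin n → ℝ) :
    Matrix (Fin n) (Fin n) ℝ := U * diagonal f * Uᵀ

section Euclidean

variable {n : ℕ}

theorem euclNorm_eq_norm (x : Fin n → ℝ) : euclNorm x = ‖WithLp.toLp 2 x‖ := by
  simp [euclNorm, EuclideanSpace.norm_eq]

theorem euclNorm_nonneg (x : Fin n → ℝ) : 0 ≤ euclNorm x := Real.sqrt_nonneg _

theorem euclNorm_smul (c : ℝ) (x : Fin n → ℝ) : euclNorm (c • x) = |c| * euclNorm x := by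
  simp [euclNorm_eq_norm, norm_smul]

theorem abs_euclDot_le (x y : Fin n → ℝ) : |euclDot x y| ≤ euclNorm x * euclNorm y := by
  rw [euclNorm_eq_norm, euclNorm_eq_norm]
  refine le_trans (le_of_eq ?_) (abs_real_inner_le_norm (WithLp.toLp 2 x) (WithLp.toLp 2 y))
  simp [euclDot, PiLp.inner_apply, mul_comm]

theorem euclNorm_eq_sqrt_dotProduct (x : Fin n → ℝ) : euclNorm x = Real.sqrt (x ⬝ᵥ x) := by
  simp [euclNorm, dotProduct, sq]

theorem euclNorm_mulVec_of_transpose_mul_self {U : Matrix (Fin n) (Fin n) ℝ} (hU : Uᵀ * U = 1)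
    (x : Fin n → ℝ) : euclNorm (U *ᵥ x) = euclNorm x := by
  rw [euclNorm_eq_sqrt_dotProduct, euclNorm_eq_sqrt_dotProduct, dotProduct_mulVec,
    ← mulVec_transpose, mulVec_mulVec, hU, one_mulVec]

theorem euclNorm_diagonal_mulVec_le {f : Fin n → ℝ} {c : ℝ} (hc : 0 ≤ c) (hf : ∀ i, |f i| ≤ c)
    (x : Fin n → ℝ) : euclNorm (diagonal f *ᵥ x) ≤ c * euclNorm x := by
  rw [← abs_of_nonneg hc, ← euclNorm_smul]
  refine Real.sqrt_le_sqrt (Finset.sum_le_sum fun i _ => ?_)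
  rw [mulVec_diagonal, Pi.smul_apply, smul_eq_mul, mul_pow, mul_pow]
  have h : f i ^ 2 ≤ c ^ 2 := sq_le_sq.2 ((hf i).trans (le_abs_self c))
  gcongr

end Euclidean

section Spectral

variable {n : ℕ} {U : Matrix (Fin n) (Fin n) ℝ}

theorem spectralMat_mul (hU : Uᵀ * U = 1) (f g : Fin n → ℝ) :
    spectralMat U f * spectralMat U g = spectralMat U fun i => f i * g i := by
  calc spectralMat U f * spectralMat U g
      = U * diagonal f * (Uᵀ * U) * diagonal g * Uᵀ := by simp only [spectralMat, Matrix.mul_assoc]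
    _ = _ := by
      rw [hU, Matrix.mul_one, Matrix.mul_assoc U, diagonal_mul_diagonal, spectralMat]

theorem spectralMat_transpose (f : Fin n → ℝ) : (spectralMat U f)ᵀ = spectralMat U f := by
  simp [spectralMat, Matrix.mul_assoc]

theorem spectralMat_add (f g : Fin n → ℝ) :
    spectralMat U f + spectralMat U g = spectralMat U fun i => f i + g i := by
  simp only [spectralMat, ← diagonal_add, Matrix.mul_add, Matrix.add_mul]

theorem spectralMat_one (hU : Uᵀ * U = 1) : spectralMat U (fun _ => 1) = 1 := by
  simp [spectralMat, mul_eq_one_comm.1 hU]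

theorem spectralMat_posSemidef {f : Fin n → ℝ} (hf : ∀ i, 0 ≤ f i) :
    (spectralMat U f).PosSemidef := by
  simpa [spectralMat, conjTranspose_eq_transpose_of_trivial] using
    (PosSemidef.diagonal (d := f) hf).mul_mul_conjTranspose_same U

theorem spectralMat_mulVec_col (hU : Uᵀ * U = 1) (f : Fin n → ℝ) (i : Fin n) :
    spectralMat U f *ᵥ U.col i = f i • U.col i := by
  rw [← mulVec_single_one, mulVec_mulVec, spectralMat, Matrix.mul_assoc, hU, Matrix.mul_one,
    ← mulVec_mulVec, diagonal_mulVec_single, mul_one, ← mulVec_smul]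
  congr 1
  rw [← Pi.single_smul, smul_eq_mul, mul_one]

theorem euclNorm_spectralMat_mulVec_le (hU : Uᵀ * U = 1) {f : Fin n → ℝ} {c : ℝ} (hc : 0 ≤ c)
    (hf : ∀ i, |f i| ≤ c) (x : Fin n → ℝ) :
    euclNorm (spectralMat U f *ᵥ x) ≤ c * euclNorm x := by
  have hUt : Uᵀᵀ * Uᵀ = 1 := by rw [transpose_transpose]; exact mul_eq_one_comm.1 hU
  rw [spectralMat, ← mulVec_mulVec, ← mulVec_mulVec, euclNorm_mulVec_of_transpose_mul_self hU,
    ← euclNorm_mulVec_of_transpose_mul_self hUt x]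
  exact euclNorm_diagonal_mulVec_le hc hf _

theorem exists_eq_of_spectralMat_mulVec_eq_smul (hU : Uᵀ * U = 1) {f : Fin n → ℝ} {μ : ℝ}
    {x : Fin n → ℝ} (hx : x ≠ 0) (h : spectralMat U f *ᵥ x = μ • x) : ∃ i, f i = μ := by
  have hw : Uᵀ *ᵥ x ≠ 0 := fun h0 => hx <| by
    rw [← one_mulVec x, ← mul_eq_one_comm.1 hU, ← mulVec_mulVec, h0, mulVec_zero]
  obtain ⟨i, hi⟩ := Function.ne_iff.1 hw
  refine ⟨i, mul_right_cancel₀ hi ?_⟩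
  have h' := congrFun (congrArg (Uᵀ *ᵥ ·) h) i
  simpa only [spectralMat, mulVec_mulVec, ← Matrix.mul_assoc, hU, Matrix.one_mul,
    ← mulVec_mulVec x (diagonal f), mulVec_diagonal, mulVec_smul, Pi.smul_apply,
    smul_eq_mul] using h'

theorem sum_smul_vecMulVec_eq_spectralMat (u : Fin n → Fin n → ℝ) (f : Fin n → ℝ) :
    ∑ i, f i • vecMulVec (u i) (u i) = spectralMat (of u)ᵀ f := by
  ext a b
  simp only [Matrix.sum_apply, Matrix.smul_apply, vecMulVec_apply, smul_eq_mul, spectralMat,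
    Matrix.mul_apply (M := _ * diagonal f), mul_diagonal, transpose_apply, of_apply]
  exact Finset.sum_congr rfl fun i _ => by ring

theorem eigenvalue_le_one (hU : Uᵀ * U = 1) {f : Fin n → ℝ}
    (h : (1 - spectralMat U f).PosSemidef) (i : Fin n) : f i ≤ 1 := by
  have h1 := h.dotProduct_mulVec_nonneg (U.col i)
  have hn : U.col i ⬝ᵥ U.col i = 1 := by
    simpa [Matrix.mul_apply, dotProduct] using congrFun (congrFun hU i) i
  rw [sub_mulVec, one_mulVec, spectralMat_mulVec_col hU, star_trivial, dotProduct_sub,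
    dotProduct_smul, hn] at h1
  simpa using h1

end Spectral

theorem exists_dyadic_between (κ : ℕ) {s : ℝ} (hs : (2 : ℝ) ^ (-(κ : ℤ)) < s) (hs1 : s ≤ 1) :
    ∃ k : ℕ, 1 ≤ k ∧ k ≤ κ ∧ (2 : ℝ) ^ (-(k : ℤ)) ≤ s ∧ s ≤ 2 * (2 : ℝ) ^ (-(k : ℤ)) := by
  induction κ with
  | zero => norm_num at hs; linarith
  | succ κ ih =>
    rcases lt_or_ge ((2 : ℝ) ^ (-(κ : ℤ))) s with h | h
    · obtain ⟨k, h1, h2, h3⟩ := ih h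
      exact ⟨k, h1, h2.trans κ.le_succ, h3⟩
    · refine ⟨κ + 1, by omega, le_rfl, hs.le, h.trans (le_of_eq ?_)⟩
      rw [← zpow_one_add₀ two_ne_zero]
      congr 1
      push_cast
      ring

theorem exists_dyadic_multiplier (κ : ℕ) {s : ℝ} (hs : (2 : ℝ) ^ (-(κ : ℤ)) < s) (hs1 : s ≤ 1) :
    ∃ m : ℝ, 1 / 2 ≤ m ∧ m ≤ 1 ∧
      ∃ k : ℕ, 1 ≤ k ∧ k ≤ κ ∧ m * s * m = (2 : ℝ) ^ (-(k : ℤ)) := by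
  obtain ⟨k, hk1, hk2, hle, hge⟩ := exists_dyadic_between κ hs hs1
  have hs0 : 0 < s := lt_trans (by positivity) hs
  refine ⟨Real.sqrt ((2 : ℝ) ^ (-(k : ℤ)) / s), Real.le_sqrt_of_sq_le ?_, ?_, k, hk1, hk2, ?_⟩
  · rw [le_div_iff₀ hs0]
    linarith
  · exact Real.sqrt_le_one.2 ((div_le_one hs0).2 hle)
  · rw [mul_right_comm, Real.mul_self_sqrt (by positivity), div_mul_cancel₀ _ hs0.ne']

/-- **Reduction to `κ`-dyadic covariance** (Lemma 4.1).  Given `n, T ≥ 2`, `κ = 8⌈log nT⌉`, and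
a positive semidefinite matrix `Σ ⪯ I` with spectral decomposition `Σ = ∑ σ_i u_i u_iᵀ`, there
is a positive semidefinite matrix `M` with the same eigenvectors, `‖M‖_op ≤ 1`, whose
Moore–Penrose pseudo-inverse `M⁺` has `‖M⁺‖_op ≤ 2`, such that `MΣM` is `κ`-dyadic and the
test-set comparison inequality holds with error term `nT‖Π_err d‖₂`. -/
theorem dyadic_covariance_reduction (n T : ℕ) (hn : 2 ≤ n) (hT : 2 ≤ T)
    (κ : ℕ) (hκ : κ = 8 * ⌈Real.log ((n : ℝ) * T)⌉₊)
    (Cov : Matrix (Fin n) (Fin n) ℝ) (hpsd : Cov.PosSemidef) (hle : (1 - Cov).PosSemidef)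
    (σ : Fin n → ℝ) (u : Fin n → (Fin n → ℝ))
    (hortho : ∀ i j, euclDot (u i) (u j) = if i = j then (1:ℝ) else 0)
    (hspec : Cov = ∑ i, σ i • Matrix.vecMulVec (u i) (u i)) :
    ∃ M Mp : Matrix (Fin n) (Fin n) ℝ,
      M.PosSemidef ∧
      -- `M` has the same eigenvectors `u₁, …, u_n`
      (∀ i, ∃ μ : ℝ, M.mulVec (u i) = μ • u i) ∧
      -- `‖M‖_op ≤ 1`
      (∀ x, euclNorm (M.mulVec x) ≤ euclNorm x) ∧
      -- `Mp` is the Moore–Penrose pseudo-inverse of `M` (the four Penrose conditions)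
      M * Mp * M = M ∧ Mp * M * Mp = Mp ∧
      (M * Mp)ᵀ = M * Mp ∧ (Mp * M)ᵀ = Mp * M ∧
      -- `‖M⁺‖_op ≤ 2`
      (∀ x, euclNorm (Mp.mulVec x) ≤ 2 * euclNorm x) ∧
      -- (i) `MΣM` is `κ`-dyadic
      (∀ (μ : ℝ) (x : Fin n → ℝ), x ≠ 0 → (M * Cov * M).mulVec x = μ • x →
        μ = 0 ∨ ∃ k : ℕ, 1 ≤ k ∧ k ≤ κ ∧ μ = (2:ℝ) ^ (-(k : ℤ))) ∧
      -- (ii) the comparison of discrepancies over test sets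
      (∀ (S : Finset (Fin n → ℝ)) (hS : S.Nonempty),
        (∀ y ∈ S, euclNorm y ≤ (n : ℝ) * T) →
        ((∀ y ∈ S, euclNorm ((1/2 : ℝ) • Mp.mulVec y) ≤ S.sup' hS fun y' => euclNorm y') ∧
         ∀ d : Fin n → ℝ,
           (S.sup' hS fun y => |euclDot d y|) ≤
             2 * (S.sup' hS fun y => |euclDot (M.mulVec d) ((1/2 : ℝ) • Mp.mulVec y)|) +
               (n : ℝ) * T *
                 euclNorm ((∑ i ∈ Finset.univ.filter fun i => σ i ≤ (2:ℝ) ^ (-(κ : ℤ)),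
                     Matrix.vecMulVec (u i) (u i)).mulVec d))) := by
  set U : Matrix (Fin n) (Fin n) ℝ := (of u)ᵀ with hUdef
  have hU : Uᵀ * U = 1 := by
    ext i j
    rw [one_apply, ← hortho i j]
    simp [hUdef, Matrix.mul_apply, euclDot]
  have hCov : Cov = spectralMat U σ := hspec.trans (sum_smul_vecMulVec_eq_spectralMat u σ)
  have hσ : ∀ i, σ i ≤ 1 := eigenvalue_le_one hU (hCov ▸ hle)
  have hm : ∀ i, ∃ m : ℝ, 0 ≤ m ∧ m ≤ 1 ∧ m⁻¹ ≤ 2 ∧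
      m * m⁻¹ + (if σ i ≤ (2 : ℝ) ^ (-(κ : ℤ)) then 1 else 0) = 1 ∧
      (m * σ i * m = 0 ∨ ∃ k : ℕ, 1 ≤ k ∧ k ≤ κ ∧ m * σ i * m = (2 : ℝ) ^ (-(k : ℤ))) := by
    intro i
    by_cases h : σ i ≤ (2 : ℝ) ^ (-(κ : ℤ))
    · exact ⟨0, le_rfl, zero_le_one, by simp, by rw [if_pos h]; simp, by simp⟩
    · obtain ⟨m, h1, h2, h3⟩ := exists_dyadic_multiplier κ (not_le.1 h) (hσ i)
      have h0 : 0 < m := by linarith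
      refine ⟨m, h0.le, h2, inv_le_of_inv_le₀ two_pos (by linarith), ?_, Or.inr h3⟩
      rw [if_neg h, mul_inv_cancel₀ h0.ne', add_zero]
  choose m hm0 hm1 hmi hmerr hmd using hm
  have hM2 : ∀ x, euclNorm (spectralMat U (fun i => (m i)⁻¹) *ᵥ x) ≤ 2 * euclNorm x :=
    euclNorm_spectralMat_mulVec_le hU two_pos.le fun i => by
      rw [abs_of_nonneg (inv_nonneg.2 (hm0 i))]
      exact hmi i
  refine ⟨spectralMat U m, spectralMat U fun i => (m i)⁻¹, spectralMat_posSemidef hm0,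
    fun i => ⟨m i, spectralMat_mulVec_col hU m i⟩, fun x => ?_, ?_, ?_, ?_, ?_, hM2, ?_, ?_⟩
  · simpa using euclNorm_spectralMat_mulVec_le hU zero_le_one
      (fun i => (abs_of_nonneg (hm0 i)).trans_le (hm1 i)) x
  · simp only [spectralMat_mul hU, mul_inv_mul_cancel]
  · simpa only [spectralMat_mul hU, inv_inv] using
      congrArg (spectralMat U) (funext fun i => mul_inv_mul_cancel (m i)⁻¹)
  · rw [spectralMat_mul hU, spectralMat_transpose]
  · rw [spectralMat_mul hU, spectralMat_transpose]
  · intro μ x hx h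
    rw [hCov, spectralMat_mul hU, spectralMat_mul hU] at h
    obtain ⟨i, rfl⟩ := exists_eq_of_spectralMat_mulVec_eq_smul hU hx h
    exact hmd i
  · intro S hS hbound
    refine ⟨fun y hy => ?_, fun d => ?_⟩
    · refine le_trans ?_ (Finset.le_sup' (fun y' => euclNorm y') hy)
      rw [euclNorm_smul, abs_of_pos one_half_pos]
      linarith [hM2 y]
    · have herr : (∑ i ∈ Finset.univ.filter fun i => σ i ≤ (2 : ℝ) ^ (-(κ : ℤ)),
          Matrix.vecMulVec (u i) (u i)) =
          spectralMat U fun i => if σ i ≤ (2 : ℝ) ^ (-(κ : ℤ)) then 1 else 0 := by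
        rw [hUdef, ← sum_smul_vecMulVec_eq_spectralMat, Finset.sum_filter]
        exact Finset.sum_congr rfl fun i _ => by split_ifs <;> simp
      rw [herr]
      set E := spectralMat U fun i => if σ i ≤ (2 : ℝ) ^ (-(κ : ℤ)) then (1 : ℝ) else 0
      set Mp := spectralMat U fun i => (m i)⁻¹ with hMp
      have hsplit : Mp * spectralMat U m + E = 1 := by
        rw [spectralMat_mul hU, spectralMat_add, ← spectralMat_one hU]
        congr 1
        funext i
        rw [mul_comm, hmerr]
      refine Finset.sup'_le _ _ fun y hy => ?_
      have hdot : euclDot d y =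
          2 * euclDot (spectralMat U m *ᵥ d) ((1 / 2 : ℝ) • Mp *ᵥ y) + euclDot (E *ᵥ d) y := by
        change d ⬝ᵥ y = 2 * ((spectralMat U m *ᵥ d) ⬝ᵥ ((1 / 2 : ℝ) • Mp *ᵥ y)) + (E *ᵥ d) ⬝ᵥ y
        have hMpt : Mpᵀ = Mp := spectralMat_transpose _
        rw [dotProduct_smul, dotProduct_mulVec, ← mulVec_transpose, hMpt, mulVec_mulVec, smul_eq_mul,
          ← mul_assoc, mul_one_div_cancel two_ne_zero, one_mul, ← add_dotProduct, ← add_mulVec,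
          hsplit, one_mulVec]
      rw [hdot]
      refine (abs_add_le _ _).trans (add_le_add ?_ ?_)
      · rw [abs_mul, abs_two]
        gcongr
        exact Finset.le_sup'
          (fun y => |euclDot (spectralMat U m *ᵥ d) ((1 / 2 : ℝ) • Mp *ᵥ y)|) hy
      · rw [mul_comm]
        exact (abs_euclDot_le _ _).trans
          (mul_le_mul_of_nonneg_left (hbound y hy) (euclNorm_nonneg _))
end

section
/- Let p be a probability distribution on ℝ^n supported on the closed Euclidean unit ball, S ⊂ ℝ^n a nonempty finite set of vectors of Euclidean norm at most 1, and let p_x be the mixture assigning probability 1/2 to a draw from p and 1/2 to a uniform draw from S. Let Π_1,…,Π_κ be orthogonal projections on ℝ^n, Π = Σ_{k=1}^κ Π_k, let λ > 0, d ∈ ℝ^n, and set Φ = Σ_{k=1}^κ E_{x∼p_x}[cosh(λ⟨d,Π_k x⟩)]. Then: (a) for every δ ∈ (0,1], P_{v∼p}( λ|⟨d,Πv⟩| > κ·log(4Φ/δ) ) ≤ δ; and (b) for every z ∈ S and every k ∈ {1,…,κ}, |⟨d,Π_k z⟩| ≤ λ^{−1}·log(4|S|Φ). -/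
open Real MeasureTheory

theorem continuous_cosh_euclDot_mulVec {n : ℕ} (lam : ℝ) (d : Fin n → ℝ)
    (M : Matrix (Fin n) (Fin n) ℝ) :
    Continuous fun x => Real.cosh (lam * euclDot d (M.mulVec x)) := by
  unfold euclDot Matrix.mulVec dotProduct
  exact Real.continuous_cosh.comp (by fun_prop)

theorem euclDot_sum_mulVec {n : ℕ} {ι : Type*} [Fintype ι] (d : Fin n → ℝ)
    (P : ι → Matrix (Fin n) (Fin n) ℝ) (v : Fin n → ℝ) :
    euclDot d ((∑ k, P k).mulVec v) = ∑ k, euclDot d ((P k).mulVec v) := by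
  simp only [euclDot, Matrix.sum_mulVec, Finset.sum_apply, Finset.mul_sum]
  exact Finset.sum_comm

theorem exp_abs_le_two_mul_cosh (x : ℝ) : Real.exp |x| ≤ 2 * Real.cosh x := by
  rw [← Real.cosh_abs, Real.cosh_eq]
  linarith [Real.exp_pos (-|x|)]

/-- A continuous function is integrable against a finite measure carried by the unit ball. -/
theorem Continuous.integrable_of_ae_sqrt_sum_sq_le_one {n : ℕ} {p : Measure (Fin n → ℝ)}
    [IsFiniteMeasure p] (hsupp : ∀ᵐ v ∂p, Real.sqrt (∑ i, v i ^ 2) ≤ 1)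
    {f : (Fin n → ℝ) → ℝ} (hf : Continuous f) : Integrable f p := by
  have hmem : ∀ᵐ v ∂p, v ∈ Set.Icc (-1 : Fin n → ℝ) 1 := by
    filter_upwards [hsupp] with v hv
    rw [Real.sqrt_le_iff, one_pow] at hv
    have habs : ∀ i, |v i| ≤ 1 := fun i => by
      rw [← sq_le_one_iff_abs_le_one]
      exact (Finset.single_le_sum (f := fun j => v j ^ 2) (fun j _ => sq_nonneg (v j))
        (Finset.mem_univ i)).trans hv.2
    exact ⟨fun i => (abs_le.mp (habs i)).1, fun i => (abs_le.mp (habs i)).2⟩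
  rw [← Measure.restrict_eq_self_of_ae_mem hmem]
  exact hf.continuousOn.integrableOn_compact isCompact_Icc

theorem integral_half_add_half_uniform {α : Type*} [MeasurableSpace α]
    [MeasurableSingletonClass α] {p : Measure α} {S : Finset α} (hS : S.Nonempty) {f : α → ℝ}
    (hf : Integrable f p) :
    ∫ x, f x ∂((2⁻¹ : ENNReal) • p +
      (2⁻¹ : ENNReal) • (S.card : ENNReal)⁻¹ • ∑ z ∈ S, Measure.dirac z) =
      2⁻¹ * ∫ x, f x ∂p + 2⁻¹ * ((S.card : ℝ)⁻¹ * ∑ z ∈ S, f z) := by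
  have hdirac : ∀ z ∈ S, Integrable f (Measure.dirac z) := fun z _ =>
    integrable_dirac enorm_lt_top
  have hcard : (S.card : ENNReal)⁻¹ ≠ ⊤ := by
    simpa using hS.ne_empty
  have hhalf : (2⁻¹ : ENNReal) ≠ ⊤ := by simp
  rw [integral_add_measure (hf.smul_measure hhalf)
    (((integrable_finsetSum_measure.2 hdirac).smul_measure hcard).smul_measure hhalf)]
  simp only [integral_smul_measure, integral_finsetSum_measure hdirac, integral_dirac]
  simp

/-- **Tail bounds from the potential** (Lemma 5.1).  With `p_x` the half/half mixture of `p`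
and the uniform distribution on the test set `S`, orthogonal projections `Π₁,…,Π_κ`,
`Π = ∑ Π_k`, and potential `Φ = ∑_k E_{x∼p_x}[cosh(λ⟨d, Π_k x⟩)]`: (a) for every
`δ ∈ (0,1]`, `P_{v∼p}(λ|⟨d,Πv⟩| > κ log(4Φ/δ)) ≤ δ`; and (b) `|⟨d, Π_k z⟩| ≤ λ⁻¹ log(4|S|Φ)`
for every `z ∈ S` and `k`. -/
theorem potential_tail_bounds (n : ℕ)
    (p : Measure (Fin n → ℝ)) [IsProbabilityMeasure p]
    (hsupp : ∀ᵐ v ∂p, Real.sqrt (∑ i, v i ^ 2) ≤ 1)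
    (S : Finset (Fin n → ℝ)) (hS : S.Nonempty)
    (hSnorm : ∀ z ∈ S, Real.sqrt (∑ i, z i ^ 2) ≤ 1)
    (px : Measure (Fin n → ℝ))
    (hpx : px = (2⁻¹ : ENNReal) • p +
      (2⁻¹ : ENNReal) • (S.card : ENNReal)⁻¹ • ∑ z ∈ S, Measure.dirac z)
    (κ : ℕ) (hκ : 1 ≤ κ)
    (P : Fin κ → Matrix (Fin n) (Fin n) ℝ)
    (hsymm : ∀ k, (P k).IsSymm) (hidem : ∀ k, P k * P k = P k)
    (lam : ℝ) (hlam : 0 < lam) (d : Fin n → ℝ)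
    (Φ : ℝ)
    (hΦ : Φ = ∑ k : Fin κ, ∫ x, Real.cosh (lam * euclDot d ((P k).mulVec x)) ∂px) :
    (∀ δ : ℝ, 0 < δ → δ ≤ 1 →
      p {v | (κ : ℝ) * Real.log (4 * Φ / δ) < lam * |euclDot d ((∑ k, P k).mulVec v)|}
        ≤ ENNReal.ofReal δ) ∧
    (∀ z ∈ S, ∀ k : Fin κ,
      |euclDot d ((P k).mulVec z)| ≤ lam⁻¹ * Real.log (4 * S.card * Φ)) := by
  have hint : ∀ k, Integrable (fun x => Real.cosh (lam * euclDot d ((P k).mulVec x))) p :=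
    fun k => (continuous_cosh_euclDot_mulVec lam d (P k)).integrable_of_ae_sqrt_sum_sq_le_one hsupp
  subst hpx
  simp only [integral_half_add_half_uniform hS (hint _)] at hΦ
  have hcard : (0 : ℝ) < S.card := by exact_mod_cast hS.card_pos
  have hI : ∀ k, 0 ≤ ∫ x, Real.cosh (lam * euclDot d ((P k).mulVec x)) ∂p :=
    fun k => integral_nonneg fun x => (Real.cosh_pos _).le
  have hI_le : ∫ x, ∑ k, Real.cosh (lam * euclDot d ((P k).mulVec x)) ∂p ≤ 2 * Φ := by
    rw [integral_finsetSum _ fun k _ => hint k, hΦ, Finset.mul_sum]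
    refine Finset.sum_le_sum fun k _ => ?_
    have : 0 ≤ (S.card : ℝ)⁻¹ * ∑ z ∈ S, Real.cosh (lam * euclDot d ((P k).mulVec z)) := by
      have := Finset.sum_nonneg fun z (_ : z ∈ S) =>
        (Real.cosh_pos (lam * euclDot d ((P k).mulVec z))).le
      positivity
    linarith
  have hz_le : ∀ z ∈ S, ∀ k,
      Real.cosh (lam * euclDot d ((P k).mulVec z)) ≤ 2 * S.card * Φ := by
    intro z hz k
    have hsum : Real.cosh (lam * euclDot d ((P k).mulVec z)) ≤
        ∑ y ∈ S, Real.cosh (lam * euclDot d ((P k).mulVec y)) :=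
      Finset.single_le_sum (f := fun y => Real.cosh (lam * euclDot d ((P k).mulVec y)))
        (fun y _ => (Real.cosh_pos _).le) hz
    have hterm : 2⁻¹ * ((S.card : ℝ)⁻¹ *
        ∑ y ∈ S, Real.cosh (lam * euclDot d ((P k).mulVec y))) ≤ Φ := by
      rw [hΦ]
      refine le_trans ?_ (Finset.single_le_sum (fun j _ => ?_) (Finset.mem_univ k))
      · linarith [hI k]
      · have := Finset.sum_nonneg fun y (_ : y ∈ S) =>
          (Real.cosh_pos (lam * euclDot d ((P j).mulVec y))).le
        have := hI j
        positivity
    refine hsum.trans ?_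
    calc ∑ y ∈ S, Real.cosh (lam * euclDot d ((P k).mulVec y))
        = 2 * S.card * (2⁻¹ * ((S.card : ℝ)⁻¹ *
            ∑ y ∈ S, Real.cosh (lam * euclDot d ((P k).mulVec y)))) := by
          field_simp
      _ ≤ 2 * S.card * Φ := by gcongr
  have hΦpos : 0 < Φ := by
    obtain ⟨z, hz⟩ := hS
    have h := (Real.cosh_pos _).trans_le (hz_le z hz ⟨0, hκ⟩)
    exact pos_of_mul_pos_right h (by positivity)
  refine ⟨fun δ hδ _ => ?_, fun z hz k => ?_⟩
  · have hsub : {v | (κ : ℝ) * Real.log (4 * Φ / δ) <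
          lam * |euclDot d ((∑ k, P k).mulVec v)|} ⊆
        {v | 2 * Φ / δ ≤ ∑ k, Real.cosh (lam * euclDot d ((P k).mulVec v))} := by
      intro v hv
      simp only [Set.mem_ofPred_eq, euclDot_sum_mulVec] at hv ⊢
      obtain ⟨k, -, hk⟩ : ∃ k ∈ Finset.univ, Real.log (4 * Φ / δ) <
          |lam * euclDot d ((P k).mulVec v)| := by
        refine Finset.exists_lt_of_sum_lt ?_
        rw [Finset.sum_const, Finset.card_univ, Fintype.card_fin, nsmul_eq_mul]
        refine hv.trans_le ?_
        simp only [abs_mul, abs_of_pos hlam, ← Finset.mul_sum]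
        gcongr
        exact Finset.abs_sum_le_sum_abs _ _
      rw [Real.log_lt_iff_lt_exp (by positivity)] at hk
      have hcosh := hk.trans_le (exp_abs_le_two_mul_cosh _)
      have hdouble : 4 * Φ / δ = 2 * (2 * Φ / δ) := by ring
      refine le_trans (by linarith : 2 * Φ / δ ≤ _) (Finset.single_le_sum
        (f := fun k => Real.cosh (lam * euclDot d ((P k).mulVec v)))
        (fun j _ => (Real.cosh_pos _).le) (Finset.mem_univ k))
    have hmarkov := mul_meas_ge_le_integral_of_nonneg (μ := p)
      (f := fun v => ∑ k, Real.cosh (lam * euclDot d ((P k).mulVec v)))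
      (Filter.Eventually.of_forall fun v => Finset.sum_nonneg fun k _ => (Real.cosh_pos _).le)
      (integrable_finsetSum _ fun k _ => hint k) (2 * Φ / δ)
    refine (measure_mono hsub).trans ?_
    rw [← ofReal_measureReal]
    refine ENNReal.ofReal_le_ofReal ?_
    have h := hmarkov.trans hI_le
    rw [div_mul_eq_mul_div, div_le_iff₀ hδ] at h
    exact le_of_mul_le_mul_left h (by positivity)
  · rw [inv_mul_eq_div, le_div_iff₀' hlam, ← abs_of_pos hlam, ← abs_mul,
      Real.le_log_iff_exp_le (by positivity)]
    linarith [exp_abs_le_two_mul_cosh (lam * euclDot d ((P k).mulVec z)), hz_le z hz k]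
end

section
/- Let n, T ≥ 2 be integers, κ = 8⌈log(nT)⌉, and let p be a mean-zero probability distribution on ℝ^n supported on the closed Euclidean unit ball whose covariance Σ = E_{v∼p}[vv^⊤] is κ-dyadic (every nonzero eigenvalue equals 2^{−k} for some k ∈ {1,…,κ}). For k ∈ {1,…,κ} let Π_k be the orthogonal projection onto the eigenspace of Σ for eigenvalue 2^{−k}. Let S ⊂ ℝ^n be a nonempty finite set of vectors of Euclidean norm at most 1, let p_x = (1/2)p + (1/2)Unif(S), set λ = 1/(100κ·log(nT)), and define Φ(d) = Σ_{k=1}^κ E_{x∼p_x}[cosh(λ⟨d,Π_k x⟩)]. Then for every d ∈ ℝ^n with ‖d‖_2 ≤ T and Φ(d) ≤ 3T^5, one has E_{v∼p}[ min_{χ∈{−1,+1}} Φ(d + χv) ] ≤ Φ(d) + 2. -/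
open Real MeasureTheory

/-- The closed Euclidean unit ball. -/
def euclBall (n : ℕ) : Set (Fin n → ℝ) := {x | euclNorm x ≤ 1}

lemma mem_euclBall_iff {n : ℕ} {x : Fin n → ℝ} : x ∈ euclBall n ↔ x ⬝ᵥ x ≤ 1 := by
  simp only [euclBall, Set.mem_ofPred_eq, euclNorm, Real.sqrt_le_one, dotProduct, pow_two]

lemma isCompact_euclBall (n : ℕ) : IsCompact (euclBall n) := by
  apply Metric.isCompact_of_isClosed_isBounded
  · have : euclBall n = {x | x ⬝ᵥ x ≤ 1} := by ext x; exact mem_euclBall_iff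
    rw [this]
    exact isClosed_le (by fun_prop) (by fun_prop)
  · refine (Metric.isBounded_closedBall (x := (0 : Fin n → ℝ)) (r := 1)).subset fun x hx => ?_
    rw [mem_euclBall_iff] at hx
    rw [mem_closedBall_zero_iff, pi_norm_le_iff_of_nonneg zero_le_one]
    intro i
    have h : x i * x i ≤ x ⬝ᵥ x :=
      Finset.single_le_sum (f := fun i => x i * x i) (fun i _ => mul_self_nonneg _)
        (Finset.mem_univ i)
    rw [Real.norm_eq_abs, abs_le]
    constructor <;> nlinarith

/-- A continuous function is integrable against a finite measure carried by a compact set. -/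
lemma Continuous.integrable_of_ae_mem_compact {X : Type*} [TopologicalSpace X] [MeasurableSpace X]
    [OpensMeasurableSpace X] [T2Space X] [TopologicalSpace.PseudoMetrizableSpace X]
    {μ : Measure X} [IsFiniteMeasure μ] {K : Set X} (hK : IsCompact K)
    (hμ : ∀ᵐ x ∂μ, x ∈ K) {f : X → ℝ} (hf : Continuous f) : Integrable f μ := by
  have h := hf.continuousOn.integrableOn_compact (μ := μ) hK
  rwa [IntegrableOn, Measure.restrict_eq_self_of_ae_mem hμ] at h

lemma Continuous.integrable_prod_of_ae_mem_compact {X Y : Type*}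
    [TopologicalSpace X] [MeasurableSpace X] [BorelSpace X] [T2Space X]
    [TopologicalSpace.PseudoMetrizableSpace X] [SecondCountableTopology X]
    [TopologicalSpace Y] [MeasurableSpace Y] [BorelSpace Y] [T2Space Y]
    [TopologicalSpace.PseudoMetrizableSpace Y] [SecondCountableTopology Y]
    {μ : Measure X} {ν : Measure Y} [IsFiniteMeasure μ] [IsFiniteMeasure ν]
    {K : Set X} {L : Set Y} (hK : IsCompact K) (hL : IsCompact L)
    (hμ : ∀ᵐ x ∂μ, x ∈ K) (hν : ∀ᵐ y ∂ν, y ∈ L) {f : X × Y → ℝ} (hf : Continuous f) :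
    Integrable f (μ.prod ν) := by
  have h := hf.continuousOn.integrableOn_compact (μ := μ.prod ν) (hK.prod hL)
  rwa [IntegrableOn, ← Measure.prod_restrict, Measure.restrict_eq_self_of_ae_mem hμ,
    Measure.restrict_eq_self_of_ae_mem hν] at h

lemma cosh_add_le {a u : ℝ} (hu : |u| ≤ 1) :
    Real.cosh (a + u) ≤ Real.cosh a + Real.sinh a * u + Real.cosh a * u ^ 2 := by
  have h1 := (abs_le.1 (Real.abs_exp_sub_one_sub_id_le hu)).2
  have h2 := (abs_le.1 (Real.abs_exp_sub_one_sub_id_le (x := -u) (by rwa [abs_neg]))).2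
  rw [Real.cosh_eq, Real.cosh_eq, Real.sinh_eq, neg_add, Real.exp_add, Real.exp_add]
  nlinarith [mul_le_mul_of_nonneg_left h1 (Real.exp_pos a).le,
    mul_le_mul_of_nonneg_left h2 (Real.exp_pos (-a)).le]

lemma abs_sinh_le_cosh (a : ℝ) : |Real.sinh a| ≤ Real.cosh a := by
  rw [abs_le, Real.cosh_eq, Real.sinh_eq]
  constructor <;> linarith [Real.exp_pos a, Real.exp_pos (-a)]

/-- Convexity of `cosh`, compared between `a` and `0`. -/
lemma cosh_sub_one_le (a : ℝ) : Real.cosh a - 1 ≤ Real.sinh a * a := by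
  have h1 := Real.add_one_le_exp a
  have h2 := Real.add_one_le_exp (-a)
  have h3 : Real.exp a * Real.exp (-a) = 1 := by rw [← Real.exp_add]; simp
  rw [Real.cosh_eq, Real.sinh_eq]
  nlinarith [mul_le_mul_of_nonneg_left h1 (Real.exp_pos (-a)).le,
    mul_le_mul_of_nonneg_left h2 (Real.exp_pos a).le]

lemma abs_le_add_cosh (M t : ℝ) : |t| ≤ M + 2 * Real.exp (-M) * Real.cosh t := by
  have h1 := Real.add_one_le_exp (|t| - M)
  rw [sub_eq_add_neg, Real.exp_add] at h1
  have h2 : Real.exp |t| ≤ 2 * Real.cosh t := by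
    rw [← Real.cosh_abs, Real.cosh_eq]
    linarith [Real.exp_pos (-|t|)]
  nlinarith [mul_le_mul_of_nonneg_right h2 (Real.exp_pos (-M)).le]

lemma abs_dotProduct_le_one {n : ℕ} {x y : Fin n → ℝ} (hx : x ⬝ᵥ x ≤ 1) (hy : y ⬝ᵥ y ≤ 1) :
    |x ⬝ᵥ y| ≤ 1 := by
  have h1 : 0 ≤ (x + y) ⬝ᵥ (x + y) := Finset.sum_nonneg fun i _ => mul_self_nonneg _
  have h2 : 0 ≤ (x - y) ⬝ᵥ (x - y) := Finset.sum_nonneg fun i _ => mul_self_nonneg _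
  simp only [add_dotProduct, dotProduct_add, sub_dotProduct, dotProduct_sub] at h1 h2
  have h3 := dotProduct_comm y x
  rw [abs_le]
  constructor <;> linarith

lemma Matrix.IsSymm.mulVec_dotProduct {n : ℕ} {A : Matrix (Fin n) (Fin n) ℝ} (hA : A.IsSymm)
    (x y : Fin n → ℝ) : A.mulVec x ⬝ᵥ y = x ⬝ᵥ A.mulVec y := by
  rw [Matrix.dotProduct_mulVec, ← Matrix.mulVec_transpose, hA.eq]

lemma proj_dotProduct_self_le {n : ℕ} {A : Matrix (Fin n) (Fin n) ℝ} (hA : A.IsSymm)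
    (hA2 : A * A = A) (x : Fin n → ℝ) : A.mulVec x ⬝ᵥ A.mulVec x ≤ x ⬝ᵥ x := by
  have h1 : 0 ≤ (x - A.mulVec x) ⬝ᵥ (x - A.mulVec x) :=
    Finset.sum_nonneg fun i _ => mul_self_nonneg _
  have h2 : A.mulVec x ⬝ᵥ A.mulVec x = x ⬝ᵥ A.mulVec x := by
    rw [hA.mulVec_dotProduct, Matrix.mulVec_mulVec, hA2]
  simp only [sub_dotProduct, dotProduct_sub] at h1
  have h3 := dotProduct_comm (A.mulVec x) x
  linarith

lemma integral_dotProduct_mul_dotProduct {n : ℕ} {p : Measure (Fin n → ℝ)} [IsFiniteMeasure p]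
    (hp : ∀ᵐ v ∂p, v ∈ euclBall n) {Cov : Matrix (Fin n) (Fin n) ℝ}
    (hCov : ∀ i j, Cov i j = ∫ v, v i * v j ∂p) (x y : Fin n → ℝ) :
    ∫ v, (v ⬝ᵥ x) * (v ⬝ᵥ y) ∂p = x ⬝ᵥ Cov.mulVec y := by
  have h : ∀ v : Fin n → ℝ, (v ⬝ᵥ x) * (v ⬝ᵥ y) =
      ∑ i, ∑ j, x i * (v i * v j * y j) := by
    intro v
    simp only [dotProduct, Finset.sum_mul_sum]
    exact Finset.sum_congr rfl fun i _ => Finset.sum_congr rfl fun j _ => by ring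
  have hI : ∀ f : (Fin n → ℝ) → ℝ, Continuous f → Integrable f p := fun f hf =>
    hf.integrable_of_ae_mem_compact (isCompact_euclBall n) hp
  simp_rw [h]
  rw [integral_finsetSum _ fun i _ => hI _ (by fun_prop)]
  simp only [dotProduct, Matrix.mulVec, Finset.mul_sum]
  refine Finset.sum_congr rfl fun i _ => ?_
  rw [integral_finsetSum _ fun j _ => hI _ (by fun_prop)]
  refine Finset.sum_congr rfl fun j _ => ?_
  rw [integral_const_mul, integral_mul_const, hCov]

set_option maxHeartbeats 1000000 in
/-- **Bounded positive drift in the Komlós setting** (Lemma 5.2).  With `κ = 8⌈log nT⌉`, a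
mean-zero distribution `p` on the unit ball with `κ`-dyadic covariance, `Π_k` the projection
onto the `2^{-k}`-eigenspace, test mixture `p_x = ½p + ½Unif(S)`, `λ = 1/(100κ log nT)` and
potential `Φ(d) = ∑_k E_{x∼p_x}[cosh(λ⟨d,Π_k x⟩)]`: whenever `‖d‖₂ ≤ T` and `Φ(d) ≤ 3T⁵`, the
greedy sign choice gives expected potential at most `Φ(d) + 2`. -/
theorem komlos_bounded_drift (n T : ℕ) (hn : 2 ≤ n) (hT : 2 ≤ T)
    (κ : ℕ) (hκ : κ = 8 * ⌈Real.log ((n : ℝ) * T)⌉₊)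
    (p : Measure (Fin n → ℝ)) [IsProbabilityMeasure p]
    (hsupp : ∀ᵐ v ∂p, euclNorm v ≤ 1)
    (hmean : ∫ v, v ∂p = 0)
    (Cov : Matrix (Fin n) (Fin n) ℝ)
    (hCov : ∀ i j, Cov i j = ∫ v, v i * v j ∂p)
    -- the covariance is `κ`-dyadic
    (hdyadic : ∀ (μ : ℝ) (x : Fin n → ℝ), x ≠ 0 → Cov.mulVec x = μ • x →
      μ = 0 ∨ ∃ k : ℕ, 1 ≤ k ∧ k ≤ κ ∧ μ = (2:ℝ) ^ (-(k : ℤ)))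
    -- `P k` is the orthogonal projection onto the eigenspace of `Cov` for eigenvalue `2^{-(k+1)}`
    (P : Fin κ → Matrix (Fin n) (Fin n) ℝ)
    (hsymm : ∀ k, (P k).IsSymm) (hidem : ∀ k, P k * P k = P k)
    (hrange : ∀ (k : Fin κ) (x : Fin n → ℝ),
      (P k).mulVec x = x ↔ Cov.mulVec x = ((2:ℝ) ^ (-(k.1 + 1 : ℤ))) • x)
    (S : Finset (Fin n → ℝ)) (hS : S.Nonempty)
    (hSnorm : ∀ z ∈ S, euclNorm z ≤ 1)
    (px : Measure (Fin n → ℝ))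
    (hpx : px = (2⁻¹ : ENNReal) • p +
      (2⁻¹ : ENNReal) • (S.card : ENNReal)⁻¹ • ∑ z ∈ S, Measure.dirac z)
    (lam : ℝ) (hlam : lam = (100 * κ * Real.log ((n : ℝ) * T))⁻¹)
    (Φ : (Fin n → ℝ) → ℝ)
    (hΦ : ∀ e, Φ e = ∑ k : Fin κ, ∫ x, Real.cosh (lam * euclDot e ((P k).mulVec x)) ∂px) :
    ∀ d : Fin n → ℝ, euclNorm d ≤ T → Φ d ≤ 3 * (T : ℝ) ^ 5 →
      ∫ v, min (Φ (d + v)) (Φ (d - v)) ∂p ≤ Φ d + 2 := by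
  intro d _ hΦd
  have hnT : (4 : ℝ) ≤ (n : ℝ) * T := by
    have h1 : (2 : ℝ) ≤ n := by exact_mod_cast hn
    have h2 : (2 : ℝ) ≤ T := by exact_mod_cast hT
    nlinarith
  obtain ⟨ℓ, hℓ⟩ : ∃ ℓ, ℓ = Real.log ((n : ℝ) * T) := ⟨_, rfl⟩
  have hℓ1 : 1 ≤ ℓ := by
    rw [hℓ, Real.le_log_iff_exp_le (by linarith)]
    linarith [Real.exp_one_lt_d9]
  rw [← hℓ] at hκ hlam
  have hκ1 : (1 : ℝ) ≤ κ := by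
    have : 0 < ⌈ℓ⌉₊ := Nat.ceil_pos.2 (by linarith)
    exact_mod_cast (by omega : 1 ≤ κ)
  have hlam0 : 0 < lam := by rw [hlam]; positivity
  have hlamκ : 100 * lam * κ * ℓ = 1 := by rw [hlam]; field_simp
  have hlamκ' : lam * κ ≤ 1 / 100 := by
    nlinarith [mul_nonneg (mul_pos hlam0 (by linarith : (0 : ℝ) < κ)).le (sub_nonneg.2 hℓ1)]
  have hlam1 : lam ≤ 1 / 100 := by nlinarith
  have hp : ∀ᵐ v ∂p, v ∈ euclBall n := hsupp
  have hcard : (S.card : ENNReal) ≠ 0 := by simpa using hS.ne_empty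
  have hfin : IsFiniteMeasure px := by
    rw [hpx]
    refine ⟨?_⟩
    simp only [Measure.add_apply, Measure.smul_apply, Measure.finsetSum_apply, measure_univ,
      smul_eq_mul, Finset.sum_const, nsmul_eq_mul, mul_one]
    rw [ENNReal.inv_mul_cancel hcard (by simp)]
    simp [ENNReal.add_lt_top]
  have hpx1 : px.real Set.univ = 1 := by
    rw [Measure.real, hpx]
    simp only [Measure.add_apply, Measure.smul_apply, Measure.finsetSum_apply, measure_univ,
      smul_eq_mul, Finset.sum_const, nsmul_eq_mul, mul_one]
    rw [ENNReal.inv_mul_cancel hcard (by simp), mul_one, ENNReal.inv_two_add_inv_two]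
    simp
  have hpxB : ∀ᵐ x ∂px, x ∈ euclBall n := by
    rw [hpx, ae_add_measure_iff]
    refine ⟨Measure.ae_smul_measure hp _, Measure.ae_smul_measure (Measure.ae_smul_measure ?_ _) _⟩
    rw [ae_iff, Measure.finsetSum_apply]
    refine Finset.sum_eq_zero fun z hz => ?_
    rw [← ae_iff]
    exact (ae_dirac_iff (isCompact_euclBall n).measurableSet).2 (hSnorm z hz)
  have hle : p ≤ (2 : ENNReal) • px := by
    rw [hpx, smul_add, smul_smul, ENNReal.mul_inv_cancel (by simp) (by simp), one_smul]
    exact Measure.le_add_right le_rfl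
  have hI : ∀ f : (Fin n → ℝ) → ℝ, Continuous f → Integrable f p := fun f hf =>
    hf.integrable_of_ae_mem_compact (isCompact_euclBall n) hp
  have hIx : ∀ f : (Fin n → ℝ) → ℝ, Continuous f → Integrable f px := fun f hf =>
    hf.integrable_of_ae_mem_compact (isCompact_euclBall n) hpxB
  have hIprod : ∀ f : (Fin n → ℝ) × (Fin n → ℝ) → ℝ, Continuous f → Integrable f (p.prod px) :=
    fun f hf => hf.integrable_prod_of_ae_mem_compact (isCompact_euclBall n) (isCompact_euclBall n)
      hp hpxB
  have hball : ∀ k, ∀ x ∈ euclBall n, (P k).mulVec x ⬝ᵥ (P k).mulVec x ≤ 1 := fun k x hx =>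
    (proj_dotProduct_self_le (hsymm k) (hidem k) x).trans (mem_euclBall_iff.1 hx)
  -- spectral facts
  set c : Fin κ → ℝ := fun k => (2 : ℝ) ^ (-(k.1 + 1 : ℤ)) with hc
  have hc0 : ∀ k, 0 < c k := fun k => by simp only [hc]; positivity
  have hc1 : ∀ k, c k ≤ 1 := fun k => zpow_le_one_of_nonpos₀ (by norm_num) (by omega)
  have hcinj : ∀ j k, c j = c k → j = k := by
    intro j k h
    have := zpow_right_injective₀ (by norm_num : (0 : ℝ) < 2) (by norm_num) h
    ext
    simpa using this
  have hCovP : ∀ k x, Cov.mulVec ((P k).mulVec x) = c k • (P k).mulVec x := fun k x =>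
    (hrange k _).1 (by rw [Matrix.mulVec_mulVec, hidem])
  have hCovsymm : Cov.IsSymm := by
    ext i j
    rw [Matrix.transpose_apply, hCov, hCov]
    simp_rw [mul_comm]
  have horth : ∀ j k x y, j ≠ k → (P k).mulVec x ⬝ᵥ (P j).mulVec y = 0 := by
    intro j k x y hjk
    have h := hCovsymm.mulVec_dotProduct ((P k).mulVec x) ((P j).mulVec y)
    rw [hCovP, hCovP, smul_dotProduct, dotProduct_smul, smul_eq_mul, smul_eq_mul] at h
    by_contra h0
    exact hjk (hcinj j k (mul_right_cancel₀ h0 h).symm)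
  -- linear and quadratic parts of the potential difference
  set a : Fin κ → (Fin n → ℝ) → ℝ := fun k x => lam * (d ⬝ᵥ (P k).mulVec x) with ha
  set u : Fin κ → (Fin n → ℝ) → (Fin n → ℝ) → ℝ :=
    fun k v x => lam * (v ⬝ᵥ (P k).mulVec x) with hu
  have hac : ∀ k, Continuous (a k) := fun k => by simp only [ha]; fun_prop
  have huc : ∀ k, Continuous fun z : (Fin n → ℝ) × (Fin n → ℝ) => u k z.1 z.2 := fun k => by
    simp only [hu]; fun_prop
  have huc' : ∀ k v, Continuous (u k v) := fun k v => by simp only [hu]; fun_prop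
  set lin : (Fin n → ℝ) → ℝ := fun v => ∑ k, ∫ x, Real.sinh (a k x) * u k v x ∂px with hlin
  set quad : (Fin n → ℝ) → ℝ := fun v => ∑ k, ∫ x, Real.cosh (a k x) * u k v x ^ 2 ∂px with hquad
  set f : (Fin n → ℝ) → ℝ := fun v => ∑ k, a k v with hf
  have hfc : Continuous f := by simp only [hf]; fun_prop
  have hΦa : Φ d = ∑ k, ∫ x, Real.cosh (a k x) ∂px := hΦ d
  have hΦ0 : ∀ e, 0 ≤ Φ e := fun e => by
    rw [hΦ]
    exact Finset.sum_nonneg fun k _ => integral_nonneg fun x => (Real.cosh_pos _).le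
  have hu1 : ∀ k, ∀ v ∈ euclBall n, ∀ x ∈ euclBall n, |u k v x| ≤ lam := by
    intro k v hv x hx
    simp only [hu, abs_mul, abs_of_pos hlam0]
    exact mul_le_of_le_one_right hlam0.le
      (abs_dotProduct_le_one (mem_euclBall_iff.1 hv) (hball k x hx))
  have hlinI : Integrable lin p := integrable_finsetSum _ fun k _ =>
    (hIprod (fun z => Real.sinh (a k z.2) * u k z.1 z.2) (by fun_prop)).integral_prod_left
  have hquadI : Integrable quad p := integrable_finsetSum _ fun k _ =>
    (hIprod (fun z => Real.cosh (a k z.2) * u k z.1 z.2 ^ 2) (by fun_prop)).integral_prod_left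
  have hstep : ∀ v ∈ euclBall n, Φ (d + v) ≤ Φ d + lin v + quad v := by
    intro v hv
    rw [hΦ, hΦa, ← Finset.sum_add_distrib, ← Finset.sum_add_distrib]
    refine Finset.sum_le_sum fun k _ => ?_
    rw [← integral_add (hIx _ (by fun_prop)) (hIx _ (by fun_prop)),
      ← integral_add (hIx _ (by fun_prop)) (hIx _ (by fun_prop))]
    have hcont : Continuous fun x => Real.cosh (lam * ((d + v) ⬝ᵥ (P k).mulVec x)) := by fun_prop
    refine integral_mono_ae (hIx _ hcont) (hIx _ (by fun_prop)) ?_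
    filter_upwards [hpxB] with x hx
    have h : lam * euclDot (d + v) ((P k).mulVec x) = a k x + u k v x := by
      change lam * ((d + v) ⬝ᵥ (P k).mulVec x) = _
      rw [add_dotProduct, mul_add]
    rw [h]
    exact cosh_add_le ((hu1 k v hv x hx).trans (by linarith))
  have huneg : ∀ k v x, u k (-v) x = -u k v x := fun k v x => by
    simp only [hu, neg_dotProduct, mul_neg]
  have hlinneg : ∀ v, lin (-v) = -lin v := fun v => by
    simp only [hlin, huneg, mul_neg, integral_neg, Finset.sum_neg_distrib]
  have hquadneg : ∀ v, quad (-v) = quad v := fun v => by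
    simp only [hquad, huneg, neg_sq]
  have hmin : ∀ v ∈ euclBall n, min (Φ (d + v)) (Φ (d - v)) ≤ Φ d - |lin v| + quad v := by
    intro v hv
    have h1 := hstep v hv
    have h2 := hstep (-v) (by
      rw [mem_euclBall_iff, neg_dotProduct, dotProduct_neg, neg_neg]
      exact mem_euclBall_iff.1 hv)
    rw [hlinneg, hquadneg, ← sub_eq_add_neg] at h2
    rcases abs_cases (lin v) with h | h
    · exact (min_le_right _ _).trans (by linarith)
    · exact (min_le_left _ _).trans (by linarith)
  have hdrift : ∫ v, min (Φ (d + v)) (Φ (d - v)) ∂p ≤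
      Φ d - ∫ v, |lin v| ∂p + ∫ v, quad v ∂p := by
    have hI1 : Integrable (fun v => Φ d - |lin v|) p := (integrable_const _).sub hlinI.abs
    calc _ ≤ ∫ v, (Φ d - |lin v| + quad v) ∂p :=
          integral_mono_of_nonneg (ae_of_all _ fun v => le_min (hΦ0 _) (hΦ0 _))
            (hI1.add hquadI) (by filter_upwards [hp] with v hv using hmin v hv)
      _ = _ := by
          rw [integral_add hI1 hquadI, integral_sub (integrable_const _) hlinI.abs]
          simp
  -- the expected quadratic part
  have hquadE : ∫ v, quad v ∂p ≤ lam ^ 2 * ∑ k, c k * ∫ x, Real.cosh (a k x) ∂px := by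
    simp only [hquad]
    rw [integral_finsetSum _ fun k _ => (hIprod (fun z => Real.cosh (a k z.2) * u k z.1 z.2 ^ 2)
      (by fun_prop)).integral_prod_left, Finset.mul_sum]
    refine Finset.sum_le_sum fun k _ => ?_
    rw [integral_integral_swap (hIprod (fun z => Real.cosh (a k z.2) * u k z.1 z.2 ^ 2)
      (by fun_prop)), ← integral_const_mul, ← integral_const_mul]
    refine integral_mono_of_nonneg (ae_of_all _ fun x => integral_nonneg fun v =>
      mul_nonneg (Real.cosh_pos _).le (sq_nonneg _)) (hIx _ (by fun_prop)) ?_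
    filter_upwards [hpxB] with x hx
    have h : ∀ v, u k v x ^ 2 =
        lam ^ 2 * ((v ⬝ᵥ (P k).mulVec x) * (v ⬝ᵥ (P k).mulVec x)) := fun v => by
      simp only [hu]; ring
    simp_rw [h]
    rw [integral_const_mul, integral_const_mul, integral_dotProduct_mul_dotProduct hp hCov, hCovP,
      dotProduct_smul, smul_eq_mul]
    have h1 := hball k x hx
    have h2 : 0 ≤ lam ^ 2 * c k * Real.cosh (a k x) :=
      mul_nonneg (mul_nonneg (sq_nonneg _) (hc0 k).le) (Real.cosh_pos _).le
    nlinarith [mul_le_mul_of_nonneg_left h1 h2]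
  -- correlation of the linear part with the test function
  have hPd : ∀ k v, a k v = lam * (v ⬝ᵥ (P k).mulVec d) := fun k v => by
    simp only [ha]
    rw [← (hsymm k).mulVec_dotProduct, dotProduct_comm]
  have hfeq : ∀ v, f v = lam * (v ⬝ᵥ ∑ k, (P k).mulVec d) := fun v => by
    simp only [hf, hPd, dotProduct_sum, Finset.mul_sum]
  have hinner : ∀ k x, ∫ v, u k v x * f v ∂p = lam * c k * a k x := by
    intro k x
    have h : ∀ v, u k v x * f v = lam ^ 2 *
        ((v ⬝ᵥ ∑ j, (P j).mulVec d) * (v ⬝ᵥ (P k).mulVec x)) := fun v => by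
      rw [hfeq]; simp only [hu]; ring
    simp_rw [h]
    rw [integral_const_mul, integral_dotProduct_mul_dotProduct hp hCov, hCovP, dotProduct_smul,
      sum_dotProduct, Finset.sum_eq_single k (fun j _ hj => horth k j _ _ hj.symm) (by simp),
      smul_eq_mul, (hsymm k).mulVec_dotProduct, Matrix.mulVec_mulVec, hidem]
    simp only [ha]
    ring
  have hlinf : ∀ v, lin v * f v = ∑ k, ∫ x, Real.sinh (a k x) * (u k v x * f v) ∂px := by
    intro v
    simp only [hlin, Finset.sum_mul, ← mul_assoc, integral_mul_const]
  have hlinfI : ∀ k, Integrable (fun z : (Fin n → ℝ) × (Fin n → ℝ) =>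
      Real.sinh (a k z.2) * (u k z.1 z.2 * f z.1)) (p.prod px) := fun k => hIprod _ (by fun_prop)
  have hcorr : lam * (∑ k, c k * ∫ x, Real.cosh (a k x) ∂px - κ) ≤ ∫ v, lin v * f v ∂p := by
    simp_rw [hlinf]
    rw [integral_finsetSum _ fun k _ => (hlinfI k).integral_prod_left]
    have h1 : ∀ k, lam * (c k * ∫ x, Real.cosh (a k x) ∂px - 1) ≤
        ∫ v, ∫ x, Real.sinh (a k x) * (u k v x * f v) ∂px ∂p := by
      intro k
      rw [integral_integral_swap (hlinfI k)]
      simp_rw [integral_const_mul, hinner]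
      have h2 : ∫ x, (Real.cosh (a k x) - 1) ∂px ≤ ∫ x, Real.sinh (a k x) * a k x ∂px :=
        integral_mono (hIx _ (by fun_prop)) (hIx _ (by fun_prop)) fun x => cosh_sub_one_le _
      rw [integral_sub (hIx _ (by fun_prop)) (integrable_const _), integral_const, hpx1,
        one_smul] at h2
      have h3 : ∫ x, Real.sinh (a k x) * (lam * c k * a k x) ∂px =
          lam * c k * ∫ x, Real.sinh (a k x) * a k x ∂px := by
        rw [← integral_const_mul]
        congr 1
        ext x
        ring
      rw [h3, mul_assoc]
      refine mul_le_mul_of_nonneg_left ?_ hlam0.le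
      nlinarith [mul_le_mul_of_nonneg_left h2 (hc0 k).le, hc1 k]
    refine le_trans (le_of_eq ?_) (Finset.sum_le_sum fun k _ => h1 k)
    rw [← Finset.mul_sum, Finset.sum_sub_distrib]
    simp
  -- upper bound on the correlation through the absolute value of the linear part
  have hlinabs : ∀ v ∈ euclBall n, |lin v| ≤ lam * Φ d := by
    intro v hv
    rw [hΦa, Finset.mul_sum]
    refine (Finset.abs_sum_le_sum_abs _ _).trans (Finset.sum_le_sum fun k _ => ?_)
    refine abs_integral_le_integral_abs.trans ?_
    rw [← integral_const_mul]
    refine integral_mono_ae (hIx _ (by fun_prop)) (hIx _ (by fun_prop)) ?_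
    filter_upwards [hpxB] with x hx
    rw [abs_mul, mul_comm lam]
    exact mul_le_mul (abs_sinh_le_cosh _) (hu1 k v hv x hx) (abs_nonneg _) (Real.cosh_pos _).le
  have hcoshp : ∑ k, ∫ v, Real.cosh (a k v) ∂p ≤ 2 * Φ d := by
    rw [hΦa, Finset.mul_sum]
    refine Finset.sum_le_sum fun k _ => ?_
    have h := integral_mono_measure hle (ae_of_all _ fun x => (Real.cosh_pos (a k x)).le)
      ((hIx (fun x => Real.cosh (a k x)) (by fun_prop)).smul_measure (by simp))
    rw [integral_smul_measure] at h
    simpa using h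
  have hfabs : ∀ v, |f v| ≤ κ * (10 * ℓ) +
      2 * Real.exp (-(10 * ℓ)) * ∑ k, Real.cosh (a k v) := by
    intro v
    refine (Finset.abs_sum_le_sum_abs _ _).trans
      ((Finset.sum_le_sum fun k _ => abs_le_add_cosh (10 * ℓ) (a k v)).trans (le_of_eq ?_))
    rw [Finset.sum_add_distrib, Finset.mul_sum, Finset.sum_const, Finset.card_univ,
      Fintype.card_fin, nsmul_eq_mul]
  have hupper : ∫ v, lin v * f v ∂p ≤ κ * (10 * ℓ) * ∫ v, |lin v| ∂p +
      lam * Φ d * (2 * Real.exp (-(10 * ℓ))) * (2 * Φ d) := by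
    have hI2 : Integrable (fun v => ∑ k, Real.cosh (a k v)) p := hI _ (by fun_prop)
    have hI3 : Integrable (fun v => lin v * f v) p := by
      simp_rw [hlinf]
      exact integrable_finsetSum _ fun k _ => (hlinfI k).integral_prod_left
    have hpt : ∫ v, lin v * f v ∂p ≤ ∫ v, (κ * (10 * ℓ) * |lin v| +
        lam * Φ d * (2 * Real.exp (-(10 * ℓ))) * ∑ k, Real.cosh (a k v)) ∂p := by
      refine integral_mono_ae hI3 ((hlinI.abs.const_mul _).add (hI2.const_mul _)) ?_
      filter_upwards [hp] with v hv
      have hs : 0 ≤ 2 * Real.exp (-(10 * ℓ)) * ∑ k, Real.cosh (a k v) :=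
        mul_nonneg (by positivity) (Finset.sum_nonneg fun k _ => (Real.cosh_pos _).le)
      calc lin v * f v ≤ |lin v| * |f v| := by rw [← abs_mul]; exact le_abs_self _
        _ ≤ |lin v| * (κ * (10 * ℓ) + 2 * Real.exp (-(10 * ℓ)) * ∑ k, Real.cosh (a k v)) :=
          mul_le_mul_of_nonneg_left (hfabs v) (abs_nonneg _)
        _ ≤ _ := by nlinarith [mul_le_mul_of_nonneg_right (hlinabs v hv) hs]
    rw [integral_add (hlinI.abs.const_mul _) (hI2.const_mul _), integral_const_mul,
      integral_const_mul, integral_finsetSum _ fun k _ => hI _ (by fun_prop)] at hpt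
    refine hpt.trans (add_le_add_right (mul_le_mul_of_nonneg_left hcoshp ?_) _)
    exact mul_nonneg (mul_nonneg hlam0.le (hΦ0 d)) (by positivity)
  have hsmall : Φ d * (2 * Real.exp (-(10 * ℓ))) * (2 * Φ d) ≤ 1 := by
    have hT0 : (0 : ℝ) < T := by exact_mod_cast (by omega : 0 < T)
    have hn2 : (2 : ℝ) ≤ n := by exact_mod_cast hn
    have he : Real.exp (10 * ℓ) = ((n : ℝ) * T) ^ 10 := by
      rw [hℓ, mul_comm, Real.exp_mul, Real.exp_log (by linarith)]
      norm_cast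
    have hsq : Φ d ^ 2 ≤ (3 * (T : ℝ) ^ 5) ^ 2 := pow_le_pow_left₀ (hΦ0 d) hΦd 2
    have hn10 : (2 : ℝ) ^ 10 ≤ (n : ℝ) ^ 10 := pow_le_pow_left₀ (by norm_num) hn2 10
    have h36 : 4 * Φ d ^ 2 ≤ ((n : ℝ) * T) ^ 10 := by
      rw [mul_pow]
      nlinarith [mul_le_mul_of_nonneg_right hn10 (pow_pos hT0 10).le, pow_pos hT0 10]
    rw [Real.exp_neg, he]
    have hpos : 0 < ((n : ℝ) * T) ^ 10 := by positivity
    calc _ = 4 * Φ d ^ 2 / ((n : ℝ) * T) ^ 10 := by ring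
      _ ≤ 1 := (div_le_one hpos).2 h36
  set q : ℝ := ∑ k, c k * ∫ x, Real.cosh (a k x) ∂px with hq
  have hq0 : 0 ≤ q := Finset.sum_nonneg fun k _ =>
    mul_nonneg (hc0 k).le (integral_nonneg fun x => (Real.cosh_pos _).le)
  have hfinal : 10 * lam ^ 2 * (q - κ - 1) ≤ ∫ v, |lin v| ∂p := by
    have h1 : lam * (q - κ) ≤ κ * (10 * ℓ) * ∫ v, |lin v| ∂p + lam := by
      nlinarith [mul_le_mul_of_nonneg_left hsmall hlam0.le]
    have h2 := mul_le_mul_of_nonneg_left h1 (by positivity : 0 ≤ 10 * lam)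
    have h3 : 10 * lam * (κ * (10 * ℓ) * ∫ v, |lin v| ∂p + lam) =
        (100 * lam * κ * ℓ) * ∫ v, |lin v| ∂p + 10 * lam ^ 2 := by ring
    rw [h3, hlamκ] at h2
    linarith
  have h4 : lam * (lam * κ) ≤ lam * (1 / 100) := mul_le_mul_of_nonneg_left hlamκ' hlam0.le
  have h5 : lam * lam ≤ lam * (1 / 100) := mul_le_mul_of_nonneg_left hlam1 hlam0.le
  have h6 : 0 ≤ lam ^ 2 * q := mul_nonneg (sq_nonneg lam) hq0
  linarith
end
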